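/- arXiv:2311.18097 — 2 statements merged into one kernel-verified Lean document; each statement's English description precedes it below -/
import Mathlib

section
/- First-level derivative decomposition: in the first-level interpolating setup, assume additionally p₀ > p₁ > 0, q₀ > q₁ > 0 and p₀q₀ > p₁q₁ > 0. Then dψ(X,Y,p,q,𝔪,β,s,t)/dp₁ = (sign(s)/(2β√n)) Σ_{i₁=1}^{l} Σ_{i₂=1}^{l} β_{i₁} (T₂^p − T₁^p), where T₂^p = (√(1−t)/√p₁) Σ_{j=1}^{m} T^p_{2,1,j}(i₁,i₂) + (√t q₁/√(p₁q₁)) ‖y^{(i₂)}‖₂ T^{(p,q)}_{2,3}(i₁,i₂) and T₁^p = (√(1−t)/√(p₀−p₁)) Σ_{j=1}^{m} T^p_{1,1,j}(i₁,i₂) + (√t q₁/√(p₀q₀−p₁q₁)) ‖y^{(i₂)}‖₂ T^{(p,q)}_{1,3}(i₁,i₂); and dψ(X,Y,p,q,𝔪,β,s,t)/dq₁ = (sign(s)/(2β√n)) Σ_{i₁=1}^{l} Σ_{i₂=1}^{l} β_{i₁} (T₂^q − T₁^q), where T₂^q = (√(1−t)/√q₁) ‖y^{(i₂)}‖₂ T^q_{2,2}(i₁,i₂)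 + (√t p₁/√(p₁q₁)) ‖y^{(i₂)}‖₂ T^{(p,q)}_{2,3}(i₁,i₂) and T₁^q = (√(1−t)/√(q₀−q₁)) ‖y^{(i₂)}‖₂ T^q_{1,2}(i₁,i₂) + (√t p₁/√(p₀q₀−p₁q₁)) ‖y^{(i₂)}‖₂ T^{(p,q)}_{1,3}(i₁,i₂). -/
set_option linter.unusedVariables false

open MeasureTheory Real

namespace SFL

noncomputable section

/-- The sample space of one group `𝒰_k = (u^{(4,k)}, u^{(2,k)}, h^{(k)})`. -/
abbrev Us (m n : ℕ) : Type := ℝ × (Fin m → ℝ) × (Fin n → ℝ)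

/-- Standard Gaussian measure on `ℝ`. -/
def stdG : Measure ℝ := ProbabilityTheory.gaussianReal 0 1

/-- i.i.d. standard Gaussian vector measure. -/
def gVec (d : ℕ) : Measure (Fin d → ℝ) := Measure.pi fun _ => stdG

/-- i.i.d. standard Gaussian matrix measure. -/
def gMat (m n : ℕ) : Measure (Fin m → Fin n → ℝ) := Measure.pi fun _ => gVec n

/-- Law of one group `𝒰_k`. -/
def muU (m n : ℕ) : Measure (Us m n) := stdG.prod ((gVec m).prod (gVec n))

/-- Joint law of `(G, 𝒰₂)`. -/
def muGU (m n : ℕ) : Measure ((Fin m → Fin n → ℝ) × Us m n) := (gMat m n).prod (muU m n)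

/-- Euclidean norm. -/
def nrm2 {d : ℕ} (v : Fin d → ℝ) : ℝ := Real.sqrt (∑ i, v i ^ 2)

/-- Euclidean inner product. -/
def dotv {d : ℕ} (a b : Fin d → ℝ) : ℝ := ∑ i, a i * b i

variable {m n l : ℕ}

/-- The interpolating exponent `D₀^{(i₁,i₂)}`. -/
def D0 (β s t m1 p0 p1 q0 q1 : ℝ) (x : Fin l → Fin n → ℝ) (y : Fin l → Fin m → ℝ)
    (G : Fin m → Fin n → ℝ) (U1 U2 : Us m n) (i1 i2 : Fin l) : ℝ :=
  Real.sqrt t * (∑ j, ∑ k, y i2 j * (G j k * x i1 k))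
    + Real.sqrt (1 - t) * nrm2 (x i1) *
        (∑ j, y i2 j * (Real.sqrt (p0 - p1) * U1.2.1 j + Real.sqrt p1 * U2.2.1 j))
    + Real.sqrt t * nrm2 (x i1) * nrm2 (y i2) *
        (Real.sqrt (p0 * q0 - p1 * q1) * U1.1 + Real.sqrt (p1 * q1) * U2.1)
    + Real.sqrt (1 - t) * nrm2 (y i2) *
        (∑ k, (Real.sqrt (q0 - q1) * U1.2.2 k + Real.sqrt q1 * U2.2.2 k) * x i1 k)

/-- `A^{(i₁,i₂)} = exp (β D₀^{(i₁,i₂)})`. -/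
def Aq (β s t m1 p0 p1 q0 q1 : ℝ) (x : Fin l → Fin n → ℝ) (y : Fin l → Fin m → ℝ)
    (G : Fin m → Fin n → ℝ) (U1 U2 : Us m n) (i1 i2 : Fin l) : ℝ :=
  Real.exp (β * D0 β s t m1 p0 p1 q0 q1 x y G U1 U2 i1 i2)

/-- `C^{(i₁)}`. -/
def Cq (β s t m1 p0 p1 q0 q1 : ℝ) (x : Fin l → Fin n → ℝ) (y : Fin l → Fin m → ℝ)
    (G : Fin m → Fin n → ℝ) (U1 U2 : Us m n) (i1 : Fin l) : ℝ :=
  ∑ i2, Aq β s t m1 p0 p1 q0 q1 x y G U1 U2 i1 i2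

/-- `Z`. -/
def Zq (β s t m1 p0 p1 q0 q1 : ℝ) (x : Fin l → Fin n → ℝ) (y : Fin l → Fin m → ℝ)
    (G : Fin m → Fin n → ℝ) (U1 U2 : Us m n) : ℝ :=
  ∑ i1, Cq β s t m1 p0 p1 q0 q1 x y G U1 U2 i1 ^ s

/-- The first-level interpolating function `ψ`. -/
def psiq (β s t m1 p0 p1 q0 q1 : ℝ) (x : Fin l → Fin n → ℝ) (y : Fin l → Fin m → ℝ) : ℝ :=
  ∫ ω, (β * |s| * Real.sqrt (n : ℝ) * m1)⁻¹ *
      Real.log (∫ U1, Zq β s t m1 p0 p1 q0 q1 x y ω.1 U1 ω.2 ^ m1 ∂ muU m n) ∂ muGU m n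

/-- The operator `Φ_{𝒰₁}`. -/
def Phiq (β s t m1 p0 p1 q0 q1 : ℝ) (x : Fin l → Fin n → ℝ) (y : Fin l → Fin m → ℝ)
    (G : Fin m → Fin n → ℝ) (U2 : Us m n) (f : Us m n → ℝ) : ℝ :=
  (∫ U1, Zq β s t m1 p0 p1 q0 q1 x y G U1 U2 ^ m1 * f U1 ∂ muU m n) /
    (∫ U1, Zq β s t m1 p0 p1 q0 q1 x y G U1 U2 ^ m1 ∂ muU m n)

/-- `γ₀(i₁,i₂)` as a function of `𝒰₁`. -/
def gam0 (β s t m1 p0 p1 q0 q1 : ℝ) (x : Fin l → Fin n → ℝ) (y : Fin l → Fin m → ℝ)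
    (G : Fin m → Fin n → ℝ) (U2 : Us m n) (i1 i2 : Fin l) (U1 : Us m n) : ℝ :=
  Cq β s t m1 p0 p1 q0 q1 x y G U1 U2 i1 ^ s / Zq β s t m1 p0 p1 q0 q1 x y G U1 U2 *
    (Aq β s t m1 p0 p1 q0 q1 x y G U1 U2 i1 i2 / Cq β s t m1 p0 p1 q0 q1 x y G U1 U2 i1)

/-- `γ₀₁^{(1)}`. -/
def gam01 (β s t m1 p0 p1 q0 q1 : ℝ) (x : Fin l → Fin n → ℝ) (y : Fin l → Fin m → ℝ)
    (G : Fin m → Fin n → ℝ) (U2 : Us m n) (i1 i2 : Fin l) : ℝ :=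
  Phiq β s t m1 p0 p1 q0 q1 x y G U2 (gam0 β s t m1 p0 p1 q0 q1 x y G U2 i1 i2)

/-- `γ₀₂^{(1)}`. -/
def gam02 (β s t m1 p0 p1 q0 q1 : ℝ) (x : Fin l → Fin n → ℝ) (y : Fin l → Fin m → ℝ)
    (G : Fin m → Fin n → ℝ) (U2 : Us m n) (i1 i2 p2 : Fin l) : ℝ :=
  Phiq β s t m1 p0 p1 q0 q1 x y G U2
    (fun U1 => gam0 β s t m1 p0 p1 q0 q1 x y G U2 i1 i2 U1 *
      gam0 β s t m1 p0 p1 q0 q1 x y G U2 i1 p2 U1)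

/-- `γ₁^{(1)}`. -/
def gam1 (β s t m1 p0 p1 q0 q1 : ℝ) (x : Fin l → Fin n → ℝ) (y : Fin l → Fin m → ℝ)
    (G : Fin m → Fin n → ℝ) (U2 : Us m n) (i1 i2 pp1 pp2 : Fin l) : ℝ :=
  Phiq β s t m1 p0 p1 q0 q1 x y G U2
    (fun U1 => gam0 β s t m1 p0 p1 q0 q1 x y G U2 i1 i2 U1 *
      gam0 β s t m1 p0 p1 q0 q1 x y G U2 pp1 pp2 U1)

/-- `γ₂^{(1)}`. -/
def gam2 (β s t m1 p0 p1 q0 q1 : ℝ) (x : Fin l → Fin n → ℝ) (y : Fin l → Fin m → ℝ)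
    (G : Fin m → Fin n → ℝ) (U2 : Us m n) (i1 i2 pp1 pp2 : Fin l) : ℝ :=
  Phiq β s t m1 p0 p1 q0 q1 x y G U2 (gam0 β s t m1 p0 p1 q0 q1 x y G U2 i1 i2) *
    Phiq β s t m1 p0 p1 q0 q1 x y G U2 (gam0 β s t m1 p0 p1 q0 q1 x y G U2 pp1 pp2)

/-- `E_{G,𝒰₂} ⟨f⟩_{γ₀₁^{(1)}}`. -/
def EB01 (β s t m1 p0 p1 q0 q1 : ℝ) (x : Fin l → Fin n → ℝ) (y : Fin l → Fin m → ℝ)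
    (f : Fin l → Fin l → ℝ) : ℝ :=
  ∫ ω, (∑ i1, ∑ i2, f i1 i2 * gam01 β s t m1 p0 p1 q0 q1 x y ω.1 ω.2 i1 i2) ∂ muGU m n

/-- `E_{G,𝒰₂} ⟨f⟩_{γ₀₂^{(1)}}`. -/
def EB02 (β s t m1 p0 p1 q0 q1 : ℝ) (x : Fin l → Fin n → ℝ) (y : Fin l → Fin m → ℝ)
    (f : Fin l → Fin l → Fin l → ℝ) : ℝ :=
  ∫ ω, (∑ i1, ∑ i2, ∑ p2, f i1 i2 p2 * gam02 β s t m1 p0 p1 q0 q1 x y ω.1 ω.2 i1 i2 p2) ∂ muGU m n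

/-- `E_{G,𝒰₂} ⟨f⟩_{γ₁^{(1)}}`. -/
def EB1 (β s t m1 p0 p1 q0 q1 : ℝ) (x : Fin l → Fin n → ℝ) (y : Fin l → Fin m → ℝ)
    (f : Fin l → Fin l → Fin l → Fin l → ℝ) : ℝ :=
  ∫ ω, (∑ i1, ∑ i2, ∑ pp1, ∑ pp2,
      f i1 i2 pp1 pp2 * gam1 β s t m1 p0 p1 q0 q1 x y ω.1 ω.2 i1 i2 pp1 pp2) ∂ muGU m n

/-- `E_{G,𝒰₂} ⟨f⟩_{γ₂^{(1)}}`. -/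
def EB2 (β s t m1 p0 p1 q0 q1 : ℝ) (x : Fin l → Fin n → ℝ) (y : Fin l → Fin m → ℝ)
    (f : Fin l → Fin l → Fin l → Fin l → ℝ) : ℝ :=
  ∫ ω, (∑ i1, ∑ i2, ∑ pp1, ∑ pp2,
      f i1 i2 pp1 pp2 * gam2 β s t m1 p0 p1 q0 q1 x y ω.1 ω.2 i1 i2 pp1 pp2) ∂ muGU m n

/-- `T^p_{1,1,j}(i₁,i₂)`. -/
def Tp11 (β s t m1 p0 p1 q0 q1 : ℝ) (x : Fin l → Fin n → ℝ) (y : Fin l → Fin m → ℝ)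
    (j : Fin m) (i1 i2 : Fin l) : ℝ :=
  ∫ ω, (∫ U1, Zq β s t m1 p0 p1 q0 q1 x y ω.1 U1 ω.2 ^ m1 ∂ muU m n)⁻¹ *
      (∫ U1, Zq β s t m1 p0 p1 q0 q1 x y ω.1 U1 ω.2 ^ (m1 - 1) *
          Cq β s t m1 p0 p1 q0 q1 x y ω.1 U1 ω.2 i1 ^ (s - 1) *
          Aq β s t m1 p0 p1 q0 q1 x y ω.1 U1 ω.2 i1 i2 * y i2 j * U1.2.1 j ∂ muU m n) ∂ muGU m n

/-- `T^p_{2,1,j}(i₁,i₂)`. -/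
def Tp21 (β s t m1 p0 p1 q0 q1 : ℝ) (x : Fin l → Fin n → ℝ) (y : Fin l → Fin m → ℝ)
    (j : Fin m) (i1 i2 : Fin l) : ℝ :=
  ∫ ω, (∫ U1, Zq β s t m1 p0 p1 q0 q1 x y ω.1 U1 ω.2 ^ m1 ∂ muU m n)⁻¹ *
      (∫ U1, Zq β s t m1 p0 p1 q0 q1 x y ω.1 U1 ω.2 ^ (m1 - 1) *
          Cq β s t m1 p0 p1 q0 q1 x y ω.1 U1 ω.2 i1 ^ (s - 1) *
          Aq β s t m1 p0 p1 q0 q1 x y ω.1 U1 ω.2 i1 i2 * y i2 j * ω.2.2.1 j ∂ muU m n) ∂ muGU m n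

/-- `T^q_{1,2}(i₁,i₂)`. -/
def Tq12 (β s t m1 p0 p1 q0 q1 : ℝ) (x : Fin l → Fin n → ℝ) (y : Fin l → Fin m → ℝ)
    (i1 i2 : Fin l) : ℝ :=
  ∫ ω, (∫ U1, Zq β s t m1 p0 p1 q0 q1 x y ω.1 U1 ω.2 ^ m1 ∂ muU m n)⁻¹ *
      (∫ U1, Zq β s t m1 p0 p1 q0 q1 x y ω.1 U1 ω.2 ^ (m1 - 1) *
          Cq β s t m1 p0 p1 q0 q1 x y ω.1 U1 ω.2 i1 ^ (s - 1) *
          Aq β s t m1 p0 p1 q0 q1 x y ω.1 U1 ω.2 i1 i2 *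
          (dotv U1.2.2 (x i1) / nrm2 (x i1)) ∂ muU m n) ∂ muGU m n

/-- `T^q_{2,2}(i₁,i₂)`. -/
def Tq22 (β s t m1 p0 p1 q0 q1 : ℝ) (x : Fin l → Fin n → ℝ) (y : Fin l → Fin m → ℝ)
    (i1 i2 : Fin l) : ℝ :=
  ∫ ω, (∫ U1, Zq β s t m1 p0 p1 q0 q1 x y ω.1 U1 ω.2 ^ m1 ∂ muU m n)⁻¹ *
      (∫ U1, Zq β s t m1 p0 p1 q0 q1 x y ω.1 U1 ω.2 ^ (m1 - 1) *
          Cq β s t m1 p0 p1 q0 q1 x y ω.1 U1 ω.2 i1 ^ (s - 1) *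
          Aq β s t m1 p0 p1 q0 q1 x y ω.1 U1 ω.2 i1 i2 *
          (dotv ω.2.2.2 (x i1) / nrm2 (x i1)) ∂ muU m n) ∂ muGU m n

/-- `T^{(p,q)}_{1,3}(i₁,i₂)`. -/
def Tpq13 (β s t m1 p0 p1 q0 q1 : ℝ) (x : Fin l → Fin n → ℝ) (y : Fin l → Fin m → ℝ)
    (i1 i2 : Fin l) : ℝ :=
  ∫ ω, (∫ U1, Zq β s t m1 p0 p1 q0 q1 x y ω.1 U1 ω.2 ^ m1 ∂ muU m n)⁻¹ *
      (∫ U1, Zq β s t m1 p0 p1 q0 q1 x y ω.1 U1 ω.2 ^ (m1 - 1) *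
          Cq β s t m1 p0 p1 q0 q1 x y ω.1 U1 ω.2 i1 ^ (s - 1) *
          Aq β s t m1 p0 p1 q0 q1 x y ω.1 U1 ω.2 i1 i2 * U1.1 ∂ muU m n) ∂ muGU m n

/-- `T^{(p,q)}_{2,3}(i₁,i₂)`. -/
def Tpq23 (β s t m1 p0 p1 q0 q1 : ℝ) (x : Fin l → Fin n → ℝ) (y : Fin l → Fin m → ℝ)
    (i1 i2 : Fin l) : ℝ :=
  ∫ ω, (∫ U1, Zq β s t m1 p0 p1 q0 q1 x y ω.1 U1 ω.2 ^ m1 ∂ muU m n)⁻¹ *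
      (∫ U1, Zq β s t m1 p0 p1 q0 q1 x y ω.1 U1 ω.2 ^ (m1 - 1) *
          Cq β s t m1 p0 p1 q0 q1 x y ω.1 U1 ω.2 i1 ^ (s - 1) *
          Aq β s t m1 p0 p1 q0 q1 x y ω.1 U1 ω.2 i1 i2 * ω.2.1 ∂ muU m n) ∂ muGU m n


namespace Aux
section abs
variable {Ω₁ Ω₂ : Type} [MeasurableSpace Ω₁] [MeasurableSpace Ω₂]

/-- measurable functions of at most linear growth -/
def Adm (N₁ : Ω₁ → ℝ) (N₂ : Ω₂ → ℝ) (g : Ω₁ → Ω₂ → ℝ) : Prop :=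
  Measurable (Function.uncurry g) ∧ ∃ K, 0 ≤ K ∧ ∀ a b, |g a b| ≤ K * (1 + N₁ a + N₂ b)

def Tg (μ : Measure Ω₁) (ν : Measure Ω₂) (Φ g : Ω₁ → Ω₂ → ℝ) : ℝ :=
  ∫ b, (∫ a, Real.exp (Φ a b) ∂μ)⁻¹ * (∫ a, Real.exp (Φ a b) * g a b ∂μ) ∂ν

structure Good (μ : Measure Ω₁) (N : Ω₁ → ℝ) : Prop where
  meas : Measurable N
  nonneg : ∀ a, 0 ≤ N a
  int : ∀ c : ℝ, Integrable (fun a => Real.exp (c * N a)) μ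

variable {μ : Measure Ω₁} {ν : Measure Ω₂} {N₁ : Ω₁ → ℝ} {N₂ : Ω₂ → ℝ}

lemma Adm.add (h1 : ∀ a, 0 ≤ N₁ a) (h2 : ∀ a, 0 ≤ N₂ a) {f g : Ω₁ → Ω₂ → ℝ} (hf : Adm N₁ N₂ f) (hg : Adm N₁ N₂ g) :
    Adm N₁ N₂ (fun a b => f a b + g a b) := by
  obtain ⟨mf, K, hK, hf⟩ := hf
  obtain ⟨mg, L, hL, hg⟩ := hg
  refine ⟨mf.add mg, K + L, by positivity, fun a b => ?_⟩
  have := abs_add_le (f a b) (g a b)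
  have := hf a b
  have := hg a b
  linarith

lemma Adm.bmul {f w : Ω₁ → Ω₂ → ℝ} (hf : Adm N₁ N₂ f) (c : ℝ)
    (hw : Measurable (Function.uncurry w)) (hb : ∀ a b, |w a b| ≤ c) (hc : 0 ≤ c) :
    Adm N₁ N₂ (fun a b => w a b * f a b) := by
  obtain ⟨mf, K, hK, hf⟩ := hf
  refine ⟨hw.mul mf, c * K, by positivity, fun a b => ?_⟩
  rw [abs_mul, mul_assoc]
  exact mul_le_mul (hb a b) (hf a b) (abs_nonneg _) hc

lemma Adm.cmul {f : Ω₁ → Ω₂ → ℝ} (hf : Adm N₁ N₂ f) (c : ℝ) :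
    Adm N₁ N₂ (fun a b => c * f a b) :=
  hf.bmul (w := fun _ _ => c) |c| measurable_const (fun _ _ => le_rfl) (abs_nonneg _)

lemma Adm.sum (h1 : ∀ a, 0 ≤ N₁ a) (h2 : ∀ a, 0 ≤ N₂ a) {ι : Type} (s : Finset ι) {f : ι → Ω₁ → Ω₂ → ℝ}
    (hf : ∀ i, Adm N₁ N₂ (f i)) :
    Adm N₁ N₂ (fun a b => ∑ i ∈ s, f i a b) := by
  classical
  induction s using Finset.induction_on with
  | empty => exact ⟨by simpa [Function.uncurry_def] using measurable_const, 0, le_rfl, by simp⟩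
  | insert i s hi ih =>
    simp only [Finset.sum_insert hi]
    exact (hf i).add h1 h2 ih

lemma bd {Φ g : ℝ} {K L u v : ℝ} (hu : 0 ≤ u) (hv : 0 ≤ v) (hL : 0 ≤ L)
    (hΦ : |Φ| ≤ K * (1 + u + v)) (hg : |g| ≤ L * (1 + u + v)) :
    |Real.exp Φ * g| ≤ L * Real.exp ((K+1) * (1 + v)) * Real.exp ((K+1) * u) := by
  rw [abs_mul, abs_of_pos (Real.exp_pos _), mul_assoc, ← Real.exp_add]
  have h1 : Real.exp Φ ≤ Real.exp (K * (1 + u + v)) := Real.exp_le_exp.2 (le_trans (le_abs_self _) hΦ)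
  have h2 : |g| ≤ L * Real.exp (1 + u + v) := hg.trans (by
    gcongr; linarith [Real.add_one_le_exp (1 + u + v)])
  calc _ ≤ Real.exp (K * (1 + u + v)) * (L * Real.exp (1 + u + v)) := by gcongr
    _ = L * (Real.exp (K * (1 + u + v)) * Real.exp (1 + u + v)) := by ring
    _ = _ := by rw [← Real.exp_add]; ring_nf

lemma meas_left {g : Ω₁ → Ω₂ → ℝ} (hg : Measurable (Function.uncurry g)) (b : Ω₂) :
    Measurable (fun a => g a b) := hg.comp (measurable_id.prodMk measurable_const)

lemma inner_int (h1 : Good μ N₁) (h2 : Good ν N₂) {Φ g : Ω₁ → Ω₂ → ℝ}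
    (hΦ : Adm N₁ N₂ Φ) (hg : Adm N₁ N₂ g) (b : Ω₂) :
    Integrable (fun a => Real.exp (Φ a b) * g a b) μ := by
  obtain ⟨mf, K, hK, hf⟩ := hΦ
  obtain ⟨mg, L, hL, hg⟩ := hg
  refine Integrable.mono' ((h1.int (K+1)).const_mul (L * Real.exp ((K+1) * (1 + N₂ b))))
    ((meas_left mf b).exp.mul (meas_left mg b)).aestronglyMeasurable (.of_forall fun a => ?_)
  exact bd (h1.nonneg a) (h2.nonneg b) hL (hf a b) (hg a b)

lemma adm_one (h1 : ∀ a, 0 ≤ N₁ a) (h2 : ∀ a, 0 ≤ N₂ a) : Adm N₁ N₂ (fun _ _ => 1) :=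
  ⟨measurable_const, 1, zero_le_one, fun a b => by
    have := h1 a
    have := h2 b
    rw [abs_one]; linarith⟩

lemma inner_int1 (h1 : Good μ N₁) (h2 : Good ν N₂) {Φ : Ω₁ → Ω₂ → ℝ}
    (hΦ : Adm N₁ N₂ Φ) (b : Ω₂) :
    Integrable (fun a => Real.exp (Φ a b)) μ := by
  simpa using inner_int h1 h2 hΦ (adm_one h1.nonneg h2.nonneg) b

lemma inner_bd (h1 : Good μ N₁) (h2 : Good ν N₂) {Φ g : Ω₁ → Ω₂ → ℝ} {K L : ℝ} (b : Ω₂) (hL : 0 ≤ L)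
    (hΦ : ∀ a, |Φ a b| ≤ K * (1 + N₁ a + N₂ b)) (hg : ∀ a, |g a b| ≤ L * (1 + N₁ a + N₂ b)) :
    |∫ a, Real.exp (Φ a b) * g a b ∂μ| ≤
      L * Real.exp ((K+1) * (1 + N₂ b)) * ∫ a, Real.exp ((K+1) * N₁ a) ∂μ := by
  rw [← integral_const_mul, ← Real.norm_eq_abs]
  exact norm_integral_le_of_norm_le ((h1.int (K+1)).const_mul _)
    (.of_forall fun a => bd (h1.nonneg a) (h2.nonneg b) hL (hΦ a) (hg a))

lemma expint_pos [IsProbabilityMeasure μ] (h1 : Good μ N₁) (c : ℝ) :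
    0 < ∫ a, Real.exp (c * N₁ a) ∂μ := integral_exp_pos (h1.int c)

lemma inner_lb (h1 : Good μ N₁) (h2 : Good ν N₂) {Φ : Ω₁ → Ω₂ → ℝ} {K : ℝ} (b : Ω₂)
    (hm : Measurable (Function.uncurry Φ)) (hK : 0 ≤ K)
    (hΦ : ∀ a b, |Φ a b| ≤ K * (1 + N₁ a + N₂ b)) :
    Real.exp (-K * (1 + N₂ b)) * ∫ a, Real.exp (-K * N₁ a) ∂μ ≤ ∫ a, Real.exp (Φ a b) ∂μ := by
  rw [← integral_const_mul]
  refine integral_mono ((h1.int _).const_mul _) (inner_int1 h1 h2 ⟨hm, K, hK, hΦ⟩ b) fun a => ?_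
  simp only
  rw [← Real.exp_add]
  apply Real.exp_le_exp.2
  have := neg_abs_le (Φ a b)
  have := hΦ a b
  linarith

/-- constant for the outer bound -/
def cst (μ : Measure Ω₁) (N₁ : Ω₁ → ℝ) (K L : ℝ) : ℝ :=
  (∫ a, Real.exp (-K * N₁ a) ∂μ)⁻¹ * (L * ∫ a, Real.exp ((K+1) * N₁ a) ∂μ) 

lemma outer_bd [IsProbabilityMeasure μ] (h1 : Good μ N₁) (h2 : Good ν N₂) {Φ g : Ω₁ → Ω₂ → ℝ} {K L : ℝ} (b : Ω₂) (hL : 0 ≤ L)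
    (hm : Measurable (Function.uncurry Φ)) (hK : 0 ≤ K)
    (hΦ : ∀ a b, |Φ a b| ≤ K * (1 + N₁ a + N₂ b)) (hg : ∀ a, |g a b| ≤ L * (1 + N₁ a + N₂ b)) :
    |(∫ a, Real.exp (Φ a b) ∂μ)⁻¹ * ∫ a, Real.exp (Φ a b) * g a b ∂μ| ≤
      cst μ N₁ K L * Real.exp (2*K+1) * Real.exp ((2*K+1) * N₂ b) := by
  have hp := expint_pos h1 (-K)
  have hlb := inner_lb h1 h2 b hm hK hΦ
  have hlp : 0 < Real.exp (-K * (1 + N₂ b)) * ∫ a, Real.exp (-K * N₁ a) ∂μ := by positivity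
  rw [abs_mul, abs_inv, abs_of_pos (hlp.trans_le hlb)]
  calc _ ≤ (Real.exp (-K * (1 + N₂ b)) * ∫ a, Real.exp (-K * N₁ a) ∂μ)⁻¹ *
        (L * Real.exp ((K+1) * (1 + N₂ b)) * ∫ a, Real.exp ((K+1) * N₁ a) ∂μ) := by
        gcongr
        exact inner_bd h1 h2 b hL (fun a => hΦ a b) hg
    _ = cst μ N₁ K L * (Real.exp (K * (1 + N₂ b)) * Real.exp ((K+1) * (1 + N₂ b))) := by
        rw [cst, mul_inv, ← Real.exp_neg]; ring_nf
    _ = _ := by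
        rw [mul_assoc, ← Real.exp_add, ← Real.exp_add]; ring_nf

lemma meas_inner [SFinite μ] {g : Ω₁ → Ω₂ → ℝ} (hg : Measurable (Function.uncurry g)) :
    StronglyMeasurable (fun b => ∫ a, g a b ∂μ) := by
  have : StronglyMeasurable (Function.uncurry fun b a => g a b) :=
    (hg.comp measurable_swap).stronglyMeasurable
  exact this.integral_prod_right

lemma outer_meas [SFinite μ] {Φ g : Ω₁ → Ω₂ → ℝ} (hΦ : Measurable (Function.uncurry Φ))
    (hg : Measurable (Function.uncurry g)) :
    AEStronglyMeasurable (fun b => (∫ a, Real.exp (Φ a b) ∂μ)⁻¹ * ∫ a, Real.exp (Φ a b) * g a b ∂μ) ν := by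
  have e1 : Measurable (Function.uncurry fun a b => Real.exp (Φ a b)) := hΦ.exp
  have e2 : Measurable (Function.uncurry fun a b => Real.exp (Φ a b) * g a b) := hΦ.exp.mul hg
  exact ((meas_inner (μ := μ) e1).measurable.inv.mul (meas_inner (μ := μ) e2).measurable).aestronglyMeasurable

lemma outer_int [IsProbabilityMeasure μ] (h1 : Good μ N₁) (h2 : Good ν N₂) {Φ g : Ω₁ → Ω₂ → ℝ}
    (hΦ : Adm N₁ N₂ Φ) (hg : Adm N₁ N₂ g) :
    Integrable (fun b => (∫ a, Real.exp (Φ a b) ∂μ)⁻¹ * ∫ a, Real.exp (Φ a b) * g a b ∂μ) ν := by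
  obtain ⟨mf, K, hK, hf⟩ := hΦ
  obtain ⟨mg, L, hL, hg⟩ := hg
  exact Integrable.mono' ((h2.int (2*K+1)).const_mul (cst μ N₁ K L * Real.exp (2*K+1)))
    (outer_meas mf mg) (.of_forall fun b => outer_bd h1 h2 b hL mf hK hf (fun a => hg a b))

lemma Tg_sum [IsProbabilityMeasure μ] (h1 : Good μ N₁) (h2 : Good ν N₂) {Φ : Ω₁ → Ω₂ → ℝ}
    (hΦ : Adm N₁ N₂ Φ) {ι : Type} (s : Finset ι) {g : ι → Ω₁ → Ω₂ → ℝ} (hg : ∀ i, Adm N₁ N₂ (g i)) :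
    Tg μ ν Φ (fun a b => ∑ i ∈ s, g i a b) = ∑ i ∈ s, Tg μ ν Φ (g i) := by
  unfold Tg
  rw [← integral_finsetSum _ (fun i _ => outer_int h1 h2 hΦ (hg i))]
  congr 1; ext b
  simp only [Finset.mul_sum]
  rw [integral_finsetSum _ (fun i _ => inner_int h1 h2 hΦ (hg i) b), Finset.mul_sum]

lemma Tg_cmul (Φ g : Ω₁ → Ω₂ → ℝ) (c : ℝ) :
    Tg μ ν Φ (fun a b => c * g a b) = c * Tg μ ν Φ g := by
  unfold Tg
  rw [← integral_const_mul]
  congr 1; ext b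
  rw [show (fun a => Real.exp (Φ a b) * (c * g a b)) = fun a => c * (Real.exp (Φ a b) * g a b) by
    ext; ring, integral_const_mul]
  ring

lemma log_int [IsProbabilityMeasure μ] [IsProbabilityMeasure ν] (h1 : Good μ N₁) (h2 : Good ν N₂) {Φ : Ω₁ → Ω₂ → ℝ}
    (hΦ : Adm N₁ N₂ Φ) :
    Integrable (fun b => Real.log (∫ a, Real.exp (Φ a b) ∂μ)) ν := by
  obtain ⟨mf, K, hK, hf⟩ := id hΦ
  have e1 : Measurable (Function.uncurry fun a b => Real.exp (Φ a b)) := mf.exp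
  set P := ∫ a, Real.exp (-K * N₁ a) ∂μ with hP
  set Q := ∫ a, Real.exp ((K+1) * N₁ a) ∂μ with hQ
  have hp : 0 < P := expint_pos h1 _
  have hq : 0 < Q := expint_pos h1 _
  have hi : Integrable (fun b => |Real.log P| + |Real.log Q| + (K+1) * Real.exp 1 * Real.exp (1 * N₂ b)) ν :=
    (integrable_const _).add ((h2.int 1).const_mul _)
  refine hi.mono' ((meas_inner (μ := μ) e1).measurable.log).aestronglyMeasurable (.of_forall fun b => ?_)
  have hlb := inner_lb h1 h2 b mf hK hf
  have hub := inner_bd (g := fun _ _ => 1) h1 h2 b zero_le_one (fun a => hf a b) (fun a => by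
    have := h1.nonneg a
    have := h2.nonneg b
    rw [abs_one]; linarith)
  simp only [mul_one, one_mul] at hub
  rw [← hP] at hlb
  rw [← hQ] at hub
  have hlp : 0 < Real.exp (-K * (1 + N₂ b)) * P := by positivity
  have hpos := hlp.trans_le hlb
  rw [abs_of_pos hpos] at hub
  have l1 := Real.log_le_log hlp hlb
  have l2 := Real.log_le_log hpos hub
  rw [Real.log_mul (Real.exp_pos _).ne' hp.ne', Real.log_exp] at l1
  rw [Real.log_mul (Real.exp_pos _).ne' hq.ne', Real.log_exp] at l2
  have e : (K+1) * (1 + N₂ b) ≤ (K+1) * Real.exp 1 * Real.exp (1 * N₂ b) := by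
    rw [mul_assoc, ← Real.exp_add]
    gcongr
    linarith [Real.add_one_le_exp (1 + 1 * N₂ b)]
  have := h2.nonneg b
  have := neg_abs_le (Real.log P)
  have := le_abs_self (Real.log Q)
  have := abs_nonneg (Real.log P)
  have := abs_nonneg (Real.log Q)
  rw [Real.norm_eq_abs, abs_le]
  constructor <;> linarith

theorem main_abs [IsProbabilityMeasure μ] [IsProbabilityMeasure ν] (h1 : Good μ N₁) (h2 : Good ν N₂)
    {Φ Φ' : ℝ → Ω₁ → Ω₂ → ℝ} {r : ℝ} {s : Set ℝ} (hs : s ∈ nhds r) {K : ℝ} (hK : 0 ≤ K)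
    (hm : ∀ ρ, Measurable (Function.uncurry (Φ ρ))) (hm' : ∀ ρ, Measurable (Function.uncurry (Φ' ρ)))
    (hd : ∀ ρ ∈ s, ∀ a b, HasDerivAt (fun ρ => Φ ρ a b) (Φ' ρ a b) ρ)
    (hb : ∀ ρ ∈ s, ∀ a b, |Φ ρ a b| ≤ K * (1 + N₁ a + N₂ b))
    (hb' : ∀ ρ ∈ s, ∀ a b, |Φ' ρ a b| ≤ K * (1 + N₁ a + N₂ b)) :
    HasDerivAt (fun ρ => ∫ b, Real.log (∫ a, Real.exp (Φ ρ a b) ∂μ) ∂ν) (Tg μ ν (Φ r) (Φ' r)) r := by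
  obtain ⟨u, hus, huo, hru⟩ := mem_nhds_iff.1 hs
  have hA : ∀ ρ ∈ s, Adm N₁ N₂ (Φ ρ) := fun ρ h => ⟨hm ρ, K, hK, hb ρ h⟩
  have hin : ∀ ρ ∈ u, ∀ b, HasDerivAt (fun ρ => ∫ a, Real.exp (Φ ρ a b) ∂μ)
      (∫ a, Real.exp (Φ ρ a b) * Φ' ρ a b ∂μ) ρ := by
    intro ρ hρ b
    refine (hasDerivAt_integral_of_dominated_loc_of_deriv_le (μ := μ) (s := u)
      (F := fun ρ a => Real.exp (Φ ρ a b)) (F' := fun ρ a => Real.exp (Φ ρ a b) * Φ' ρ a b)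
      (bound := fun a => K * Real.exp ((K+1) * (1 + N₂ b)) * Real.exp ((K+1) * N₁ a))
      (huo.mem_nhds hρ) (.of_forall fun ρ => (meas_left (hm ρ) b).exp.aestronglyMeasurable)
      (inner_int1 h1 h2 (hA ρ (hus hρ)) b)
      ((meas_left (hm ρ) b).exp.mul (meas_left (hm' ρ) b)).aestronglyMeasurable ?_
      ((h1.int _).const_mul _) ?_).2
    · exact .of_forall fun a ρ h => bd (h1.nonneg a) (h2.nonneg b) hK (hb ρ (hus h) a b) (hb' ρ (hus h) a b)
    · exact .of_forall fun a ρ h => (hd ρ (hus h) a b).exp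
  refine (hasDerivAt_integral_of_dominated_loc_of_deriv_le (μ := ν) (s := u)
      (F := fun ρ b => Real.log (∫ a, Real.exp (Φ ρ a b) ∂μ))
      (F' := fun ρ b => (∫ a, Real.exp (Φ ρ a b) ∂μ)⁻¹ * ∫ a, Real.exp (Φ ρ a b) * Φ' ρ a b ∂μ)
      (bound := fun b => cst μ N₁ K K * Real.exp (2*K+1) * Real.exp ((2*K+1) * N₂ b))
      (huo.mem_nhds hru) (.of_forall fun ρ => ?_)
      (log_int h1 h2 (hA r (hus hru)))
      (outer_meas (hm r) (hm' r)) ?_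
      ((h2.int _).const_mul _) ?_).2
  · have e1 : Measurable (Function.uncurry fun a b => Real.exp (Φ ρ a b)) := (hm ρ).exp
    exact ((meas_inner (μ := μ) e1).measurable.log).aestronglyMeasurable
  · exact .of_forall fun b ρ h => outer_bd h1 h2 b hK (hm ρ) hK (hb ρ (hus h)) (fun a => hb' ρ (hus h) a b)
  · refine .of_forall fun b ρ h => ?_
    have := (hin ρ h b).log (integral_exp_pos (inner_int1 h1 h2 (hA ρ (hus h)) b)).ne'
    simpa [div_eq_inv_mul] using this

end abs

section B
variable {l : ℕ}

def cC (β : ℝ) (d : Fin l → Fin l → ℝ) (i : Fin l) : ℝ := ∑ j, Real.exp (β * d i j)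
def zZ (β s : ℝ) (d : Fin l → Fin l → ℝ) : ℝ := ∑ i, cC β d i ^ s
def LZ (β s m1 : ℝ) (d : Fin l → Fin l → ℝ) : ℝ := m1 * Real.log (zZ β s d)
def wW (β s : ℝ) (d : Fin l → Fin l → ℝ) (i j : Fin l) : ℝ :=
  (zZ β s d)⁻¹ * (cC β d i ^ (s - 1) * Real.exp (β * d i j))

lemma cC_pos (hl : 1 ≤ l) (β : ℝ) (d : Fin l → Fin l → ℝ) (i : Fin l) : 0 < cC β d i :=
  Finset.sum_pos (fun _ _ => Real.exp_pos _) ⟨⟨0, hl⟩, Finset.mem_univ _⟩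

lemma zZ_pos (hl : 1 ≤ l) (β s : ℝ) (d : Fin l → Fin l → ℝ) : 0 < zZ β s d :=
  Finset.sum_pos (fun _ _ => Real.rpow_pos_of_pos (cC_pos hl _ _ _) _) ⟨⟨0, hl⟩, Finset.mem_univ _⟩

lemma exp_LZ (hl : 1 ≤ l) (β s m1 : ℝ) (d : Fin l → Fin l → ℝ) :
    Real.exp (LZ β s m1 d) = zZ β s d ^ m1 := by
  rw [LZ, Real.rpow_def_of_pos (zZ_pos hl _ _ _), mul_comm]

lemma exp_LZ_w (hl : 1 ≤ l) (β s m1 : ℝ) (d : Fin l → Fin l → ℝ) (i j : Fin l) (e : ℝ) :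
    Real.exp (LZ β s m1 d) * (wW β s d i j * e) =
      zZ β s d ^ (m1 - 1) * cC β d i ^ (s - 1) * Real.exp (β * d i j) * e := by
  rw [exp_LZ hl, Real.rpow_sub_one (zZ_pos hl _ _ _).ne', wW]
  ring

lemma lse_bd (hl : 1 ≤ l) (a : Fin l → ℝ) {B : ℝ} (h : ∀ i, |a i| ≤ B) :
    |Real.log (∑ i, Real.exp (a i))| ≤ Real.log l + B := by
  have hl' : (1:ℝ) ≤ l := by exact_mod_cast hl
  have hlp : (0:ℝ) < l := by linarith
  have h0 : 0 ≤ Real.log l := Real.log_nonneg hl'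
  have hub : ∑ i, Real.exp (a i) ≤ l * Real.exp B := by
    calc _ ≤ ∑ _i : Fin l, Real.exp B := Finset.sum_le_sum fun i _ =>
          Real.exp_le_exp.2 ((le_abs_self _).trans (h i))
      _ = _ := by simp
  have hlb : Real.exp (-B) ≤ ∑ i, Real.exp (a i) := by
    calc _ ≤ Real.exp (a ⟨0, hl⟩) := Real.exp_le_exp.2 (by
            have := neg_abs_le (a ⟨0, hl⟩)
            have := h ⟨0, hl⟩
            linarith)
      _ ≤ _ := Finset.single_le_sum (f := fun i => Real.exp (a i)) (fun i _ => (Real.exp_pos _).le) (Finset.mem_univ _)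
  have hpos := (Real.exp_pos _).trans_le hlb
  have l1 := Real.log_le_log (Real.exp_pos _) hlb
  have l2 := Real.log_le_log hpos hub
  rw [Real.log_exp] at l1
  rw [Real.log_mul hlp.ne' (Real.exp_pos _).ne', Real.log_exp] at l2
  rw [abs_le]; constructor <;> linarith

lemma LZ_bd (hl : 1 ≤ l) (β s m1 : ℝ) (d : Fin l → Fin l → ℝ) {B : ℝ} (h : ∀ i j, |d i j| ≤ B) :
    |LZ β s m1 d| ≤ |m1| * (Real.log l + |s| * (Real.log l + |β| * B)) := by
  rw [LZ, abs_mul]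
  gcongr
  have : zZ β s d = ∑ i, Real.exp (Real.log (cC β d i) * s) :=
    Finset.sum_congr rfl fun i _ => Real.rpow_def_of_pos (cC_pos hl _ _ _) _
  rw [this]
  refine lse_bd hl _ fun i => ?_
  rw [abs_mul, mul_comm]
  gcongr
  refine lse_bd hl _ fun j => ?_
  rw [abs_mul]
  gcongr
  exact h i j

lemma w_bd (hl : 1 ≤ l) (β s : ℝ) (d : Fin l → Fin l → ℝ) (i j : Fin l) : |wW β s d i j| ≤ 1 := by
  have hz := zZ_pos hl β s d
  have hc := cC_pos hl β d i
  rw [abs_of_nonneg (by unfold wW; positivity), wW, inv_mul_le_one₀ hz]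
  calc _ ≤ cC β d i ^ (s-1) * cC β d i := by
        gcongr
        exact Finset.single_le_sum (f := fun j => Real.exp (β * d i j)) (fun i _ => (Real.exp_pos _).le) (Finset.mem_univ _)
    _ = cC β d i ^ s := by rw [← Real.rpow_add_one hc.ne']; ring_nf
    _ ≤ _ := Finset.single_le_sum (f := fun i => cC β d i ^ s) (fun i _ => (Real.rpow_pos_of_pos (cC_pos hl _ _ _) _).le) (Finset.mem_univ _)

lemma LZ_deriv (hl : 1 ≤ l) (β s m1 : ℝ) (d : ℝ → Fin l → Fin l → ℝ) (d' : Fin l → Fin l → ℝ) (r : ℝ)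
    (h : ∀ i j, HasDerivAt (fun ρ => d ρ i j) (d' i j) r) :
    HasDerivAt (fun ρ => LZ β s m1 (d ρ)) (∑ i, ∑ j, m1 * s * β * (wW β s (d r) i j * d' i j)) r := by
  have hC : ∀ i, HasDerivAt (fun ρ => cC β (d ρ) i) (∑ j, Real.exp (β * d r i j) * (β * d' i j)) r := by
    intro i
    exact HasDerivAt.fun_sum fun j _ => ((h i j).const_mul β).exp
  have hZ : HasDerivAt (fun ρ => zZ β s (d ρ))
      (∑ i, (∑ j, Real.exp (β * d r i j) * (β * d' i j)) * s * cC β (d r) i ^ (s-1)) r :=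
    HasDerivAt.fun_sum fun i _ => (hC i).rpow_const (Or.inl (cC_pos hl _ _ _).ne')
  have := (hZ.log (zZ_pos hl _ _ _).ne').const_mul m1
  refine this.congr_deriv ?_
  rw [Finset.sum_div, Finset.mul_sum]
  refine Finset.sum_congr rfl fun i _ => ?_
  simp only [Finset.sum_mul, Finset.sum_div, Finset.mul_sum]
  refine Finset.sum_congr rfl fun j _ => ?_
  rw [wW]; ring

variable {Ω : Type} [MeasurableSpace Ω]
lemma meas_C (β : ℝ) {d : Ω → Fin l → Fin l → ℝ} (h : ∀ i j, Measurable fun a => d a i j) (i : Fin l) :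
    Measurable fun a => cC β (d a) i :=
  Finset.measurable_fun_sum _ fun j _ => ((h i j).const_mul β).exp
lemma meas_Z (β s : ℝ) {d : Ω → Fin l → Fin l → ℝ} (h : ∀ i j, Measurable fun a => d a i j)  :
    Measurable fun a => zZ β s (d a) :=
  Finset.measurable_fun_sum _ fun j _ => (meas_C β h j).pow_const s
lemma meas_LZ (β s m1 : ℝ) {d : Ω → Fin l → Fin l → ℝ} (h : ∀ i j, Measurable fun a => d a i j)  :
    Measurable fun a => LZ β s m1 (d a) := (meas_Z β s h).log.const_mul _
lemma meas_W (β s : ℝ) {d : Ω → Fin l → Fin l → ℝ} (h : ∀ i j, Measurable fun a => d a i j) (i j : Fin l) :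
    Measurable fun a => wW β s (d a) i j :=
  (meas_Z β s h).inv.mul (((meas_C β h i).pow_const _).mul ((h i j).const_mul β).exp)
end B

section core
variable {Ω₁ Ω₂ : Type} [MeasurableSpace Ω₁] [MeasurableSpace Ω₂]
variable {μ : Measure Ω₁} {ν : Measure Ω₂} {N₁ : Ω₁ → ℝ} {N₂ : Ω₂ → ℝ}

lemma Adm.abs {f : Ω₁ → Ω₂ → ℝ} (hf : Adm N₁ N₂ f) : Adm N₁ N₂ (fun a b => |f a b|) := by
  obtain ⟨mf, K, hK, hf⟩ := hf
  exact ⟨measurable_norm.comp mf, K, hK, by simpa using hf⟩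

lemma nbhd_c {κ : Type} [Fintype κ] {c : κ → ℝ → ℝ} {r : ℝ} (hc : ∀ k, ContDiffAt ℝ 1 (c k) r) :
    ∃ M : ℝ, 0 ≤ M ∧ ∀ᶠ ρ in nhds r, ∀ k, |c k ρ| ≤ M ∧ |deriv (c k) ρ| ≤ M ∧
      HasDerivAt (c k) (deriv (c k) ρ) ρ := by
  refine ⟨∑ k, (|c k r| + 1 + (|deriv (c k) r| + 1)), by positivity, ?_⟩
  rw [Filter.eventually_all]
  intro k
  have h1 : ∀ᶠ ρ in nhds r, |c k ρ| < |c k r| + 1 :=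
    (hc k).continuousAt.abs.eventually_lt continuousAt_const (by simp)
  have h2 : ∀ᶠ ρ in nhds r, |deriv (c k) ρ| < |deriv (c k) r| + 1 := by
    have : ContinuousAt (deriv (c k)) r := by
      have h0 : ContDiffAt ℝ 0 (fderiv ℝ (c k)) r := (hc k).fderiv_right (by simp)
      exact (h0.continuousAt.clm_apply (continuousAt_const (y := (1:ℝ))))
    exact this.abs.eventually_lt continuousAt_const (by simp)
  have h3 : ∀ᶠ ρ in nhds r, DifferentiableAt ℝ (c k) ρ :=
    ((hc k).eventually (by simp)).mono fun ρ h => h.differentiableAt (by simp)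
  have hle : (|c k r| + 1 + (|deriv (c k) r| + 1)) ≤ ∑ k, (|c k r| + 1 + (|deriv (c k) r| + 1)) :=
    Finset.single_le_sum (f := fun k => (|c k r| + 1 + (|deriv (c k) r| + 1)))
      (fun _ _ => by positivity) (Finset.mem_univ k)
  filter_upwards [h1, h2, h3] with ρ a b c'
  have := abs_nonneg (c k r)
  have := abs_nonneg (deriv (c k) r)
  exact ⟨by linarith, by linarith, c'.hasDerivAt⟩

theorem core [IsProbabilityMeasure μ] [IsProbabilityMeasure ν] (h1 : Good μ N₁) (h2 : Good ν N₂)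
    {l : ℕ} (hl : 1 ≤ l) (β s m1 : ℝ) {κ : Type} [Fintype κ] {c : κ → ℝ → ℝ} {r : ℝ}
    (hc : ∀ k, ContDiffAt ℝ 1 (c k) r)
    (g : Fin l → Fin l → Ω₁ → Ω₂ → ℝ) (e : κ → Fin l → Fin l → Ω₁ → Ω₂ → ℝ)
    (hg : ∀ i j, Adm N₁ N₂ (g i j)) (he : ∀ k i j, Adm N₁ N₂ (e k i j))
    (D : ℝ → Fin l → Fin l → Ω₁ → Ω₂ → ℝ)
    (hD : ∀ ρ i j a b, D ρ i j a b = g i j a b + ∑ k, c k ρ * e k i j a b) :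
    (Adm N₁ N₂ (fun a b => LZ β s m1 (fun i j => D r i j a b))) ∧
    (∀ i j f, Adm N₁ N₂ f → Adm N₁ N₂ (fun a b => wW β s (fun i j => D r i j a b) i j * f a b)) ∧
    HasDerivAt (fun ρ => ∫ b, Real.log (∫ a, Real.exp (LZ β s m1 (fun i j => D ρ i j a b)) ∂μ) ∂ν)
      (m1 * s * β * ∑ i, ∑ j, ∑ k, deriv (c k) r *
        Tg μ ν (fun a b => LZ β s m1 (fun i j => D r i j a b))
          (fun a b => wW β s (fun i j => D r i j a b) i j * e k i j a b)) r := by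
  obtain ⟨M, hM, hev⟩ := nbhd_c hc
  have n1 := h1.nonneg
  have n2 := h2.nonneg
  set B : Ω₁ → Ω₂ → ℝ := fun a b => ∑ i, ∑ j, (|g i j a b| + ∑ k, M * |e k i j a b|) with hB
  have hBA : Adm N₁ N₂ B := Adm.sum n1 n2 _ fun i => Adm.sum n1 n2 _ fun j =>
    (hg i j).abs.add n1 n2 (Adm.sum n1 n2 _ fun k => (he k i j).abs.cmul M)
  obtain ⟨-, KB, hKB, hBb⟩ := hBA
  have hle : ∀ i j a b, (|g i j a b| + ∑ k, M * |e k i j a b|) ≤ B a b := by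
    intro i j a b
    have p1 := Finset.single_le_sum (f := fun j => (|g i j a b| + ∑ k, M * |e k i j a b|))
      (fun _ _ => by positivity) (Finset.mem_univ j)
    have p2 := Finset.single_le_sum (f := fun i => ∑ j, (|g i j a b| + ∑ k, M * |e k i j a b|))
      (fun _ _ => by positivity) (Finset.mem_univ i)
    exact p1.trans p2
  have hle' : ∀ a b, B a b ≤ KB * (1 + N₁ a + N₂ b) := fun a b => (le_abs_self _).trans (hBb a b)
  have hsum : ∀ (v : κ → ℝ), (∀ k, |v k| ≤ M) → ∀ i j a b,
      |∑ k, v k * e k i j a b| ≤ ∑ k, M * |e k i j a b| := by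
    intro v hv i j a b
    refine (Finset.abs_sum_le_sum_abs _ _).trans (Finset.sum_le_sum fun k _ => ?_)
    rw [abs_mul]
    gcongr
    exact hv k
  have mD : ∀ ρ i j, Measurable (Function.uncurry (D ρ i j)) := by
    intro ρ i j
    have : D ρ i j = fun a b => g i j a b + ∑ k, c k ρ * e k i j a b := by
      ext a b; exact hD ρ i j a b
    rw [this]
    exact ((hg i j).add n1 n2 (Adm.sum n1 n2 _ fun k => (he k i j).cmul _)).1
  set D' : ℝ → Fin l → Fin l → Ω₁ → Ω₂ → ℝ := fun ρ i j a b => ∑ k, deriv (c k) ρ * e k i j a b with hD'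
  have mD' : ∀ ρ i j, Measurable (Function.uncurry (D' ρ i j)) := fun ρ i j =>
    (Adm.sum n1 n2 Finset.univ fun k => (he k i j).cmul (deriv (c k) ρ)).1
  have mW : ∀ ρ i j, Measurable (Function.uncurry fun a b => wW β s (fun i j => D ρ i j a b) i j) :=
    fun ρ i j => meas_W (Ω := Ω₁ × Ω₂) β s (d := fun p i j => D ρ i j p.1 p.2) (fun i j => mD ρ i j) i j
  have mLZ : ∀ ρ, Measurable (Function.uncurry fun a b => LZ β s m1 (fun i j => D ρ i j a b)) :=
    fun ρ => meas_LZ (Ω := Ω₁ × Ω₂) β s m1 (d := fun p i j => D ρ i j p.1 p.2) (fun i j => mD ρ i j)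
  have hl0 : 0 ≤ Real.log (l:ℝ) := Real.log_nonneg (by exact_mod_cast hl)
  set K1 := |m1| * (Real.log l + |s| * (Real.log l + |β| * KB)) with hK1
  set K2 := ∑ _i : Fin l, ∑ _j : Fin l, |m1 * s * β| * KB with hK2
  have hK1p : 0 ≤ K1 := by positivity
  have hK2p : 0 ≤ K2 := by positivity
  have hS1 : ∀ a b, 1 ≤ 1 + N₁ a + N₂ b := fun a b => by
    have := n1 a
    have := n2 b
    linarith
  have hΦb : ∀ ρ ∈ {ρ | ∀ k, |c k ρ| ≤ M ∧ |deriv (c k) ρ| ≤ M ∧ HasDerivAt (c k) (deriv (c k) ρ) ρ}, ∀ a b,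
      |LZ β s m1 (fun i j => D ρ i j a b)| ≤ K1 * (1 + N₁ a + N₂ b) := by
    intro ρ hρ a b
    have hdb : ∀ i j, |D ρ i j a b| ≤ KB * (1 + N₁ a + N₂ b) := by
      intro i j
      rw [hD]
      refine (abs_add_le _ _).trans (le_trans ?_ ((hle i j a b).trans (hle' a b)))
      gcongr
      exact hsum _ (fun k => (hρ k).1) i j a b
    refine (LZ_bd hl β s m1 _ hdb).trans ?_
    rw [hK1, mul_assoc]
    refine mul_le_mul_of_nonneg_left ?_ (abs_nonneg _)
    have h3 := mul_le_mul_of_nonneg_left (hS1 a b) hl0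
    have h4 := mul_le_mul_of_nonneg_left h3 (abs_nonneg s)
    nlinarith
  have hΦA : Adm N₁ N₂ (fun a b => LZ β s m1 (fun i j => D r i j a b)) :=
    ⟨mLZ r, K1, hK1p, hΦb r hev.self_of_nhds⟩
  have hWA : ∀ i j f, Adm N₁ N₂ f → Adm N₁ N₂ (fun a b => wW β s (fun i j => D r i j a b) i j * f a b) :=
    fun i j f hf => hf.bmul 1 (mW r i j) (fun a b => w_bd hl _ _ _ _ _) zero_le_one
  refine ⟨hΦA, hWA, ?_⟩
  have main := main_abs h1 h2 (K := K1 + K2) (r := r) hev (by positivity)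
    (Φ := fun ρ a b => LZ β s m1 (fun i j => D ρ i j a b))
    (Φ' := fun ρ a b => ∑ i, ∑ j, m1 * s * β * (wW β s (fun i j => D ρ i j a b) i j * D' ρ i j a b))
    mLZ ?_ ?_ ?_ ?_
  · refine main.congr_deriv ?_
    rw [Tg_sum h1 h2 hΦA, Finset.mul_sum]
    rotate_left
    · intro i
      exact Adm.sum n1 n2 _ fun j => (hWA i j _ (Adm.sum n1 n2 _ fun k => (he k i j).cmul _)).cmul _
    refine Finset.sum_congr rfl fun i _ => ?_
    rw [Tg_sum h1 h2 hΦA, Finset.mul_sum]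
    rotate_left
    · intro j
      exact (hWA i j _ (Adm.sum n1 n2 _ fun k => (he k i j).cmul _)).cmul _
    refine Finset.sum_congr rfl fun j _ => ?_
    rw [Tg_cmul]
    congr 1
    have : (fun a b => wW β s (fun i j => D r i j a b) i j * D' r i j a b) =
        fun a b => ∑ k, deriv (c k) r * (wW β s (fun i j => D r i j a b) i j * e k i j a b) := by
      ext a b
      rw [hD']
      simp only [Finset.mul_sum]
      exact Finset.sum_congr rfl fun k _ => by ring
    rw [this, Tg_sum h1 h2 hΦA _ (fun k => (hWA i j _ (he k i j)).cmul _)]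
    exact Finset.sum_congr rfl fun k _ => Tg_cmul _ _ _
  · intro ρ
    exact Finset.measurable_fun_sum _ fun i _ => Finset.measurable_fun_sum _ fun j _ =>
      ((mW ρ i j).mul (mD' ρ i j)).const_mul _
  · intro ρ hρ a b
    refine LZ_deriv hl β s m1 (fun ρ i j => D ρ i j a b) _ ρ fun i j => ?_
    simp only [hD]
    exact (HasDerivAt.fun_sum fun k _ => ((hρ k).2.2.mul_const _)).const_add _
  · intro ρ hρ a b
    refine (hΦb ρ hρ a b).trans ?_
    have := hS1 a b
    gcongr
    linarith
  · intro ρ hρ a b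
    have : |∑ i, ∑ j, m1 * s * β * (wW β s (fun i j => D ρ i j a b) i j * D' ρ i j a b)| ≤
        K2 * (1 + N₁ a + N₂ b) := by
      rw [hK2, Finset.sum_mul]
      refine (Finset.abs_sum_le_sum_abs _ _).trans (Finset.sum_le_sum fun i _ => ?_)
      rw [Finset.sum_mul]
      refine (Finset.abs_sum_le_sum_abs _ _).trans (Finset.sum_le_sum fun j _ => ?_)
      rw [abs_mul (m1 * s * β), mul_assoc |m1 * s * β|, abs_mul (wW β s _ i j)]
      refine mul_le_mul_of_nonneg_left ?_ (abs_nonneg _)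
      have q1 := w_bd hl β s (fun i j => D ρ i j a b) i j
      have q2 : |D' ρ i j a b| ≤ KB * (1 + N₁ a + N₂ b) := by
        refine (hsum _ (fun k => (hρ k).2.1) i j a b).trans (le_trans ?_ ((hle i j a b).trans (hle' a b)))
        linarith [abs_nonneg (g i j a b)]
      calc _ ≤ 1 * |D' ρ i j a b| := by gcongr
        _ ≤ _ := by rw [one_mul]; exact q2
    refine this.trans ?_
    have := hS1 a b
    gcongr
    linarith
end core
end Aux

namespace Aux
section conc
open ProbabilityTheory

lemma good_std : Good stdG (fun a => |a|) where
  meas := measurable_norm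
  nonneg := abs_nonneg
  int c := integrable_exp_mul_abs (X := fun a => a) (μ := stdG) (integrable_exp_mul_gaussianReal c) (integrable_exp_mul_gaussianReal (-c))

instance : IsProbabilityMeasure stdG := by unfold stdG; infer_instance
instance (d : ℕ) : IsProbabilityMeasure (gVec d) := by unfold gVec; infer_instance
instance (m n : ℕ) : IsProbabilityMeasure (gMat m n) := by unfold gMat; infer_instance
instance (m n : ℕ) : IsProbabilityMeasure (muU m n) := by unfold muU; infer_instance
instance (m n : ℕ) : IsProbabilityMeasure (muGU m n) := by unfold muGU; infer_instance

lemma Good.pi {Ω : Type} [MeasurableSpace Ω] {μ : Measure Ω} [IsProbabilityMeasure μ] {N : Ω → ℝ} (h : Good μ N) (d : ℕ) :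
    Good (Measure.pi fun _ : Fin d => μ) (fun v => ∑ i, N (v i)) where
  meas := Finset.measurable_fun_sum _ fun i _ => h.meas.comp (measurable_pi_apply i)
  nonneg a := Finset.sum_nonneg fun i _ => h.nonneg _
  int c := by
    simp only [Finset.mul_sum, Real.exp_sum]
    exact Integrable.fintype_prod (f := fun _ a => Real.exp (c * N a)) (fun _ => h.int c)

lemma Good.prod {Ω Ω' : Type} [MeasurableSpace Ω] [MeasurableSpace Ω'] {μ : Measure Ω} [IsProbabilityMeasure μ]
    {ν : Measure Ω'} [IsProbabilityMeasure ν] {N : Ω → ℝ} {N' : Ω' → ℝ} (h : Good μ N) (h' : Good ν N') :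
    Good (μ.prod ν) (fun v => N v.1 + N' v.2) where
  meas := (h.meas.comp measurable_fst).add (h'.meas.comp measurable_snd)
  nonneg a := add_nonneg (h.nonneg _) (h'.nonneg _)
  int c := by
    simp only [mul_add, Real.exp_add]
    exact (h.int c).mul_prod (h'.int c)

def nU (m n : ℕ) (U : Us m n) : ℝ := |U.1| + (∑ j, |U.2.1 j| + ∑ k, |U.2.2 k|)
def nW (m n : ℕ) (ω : (Fin m → Fin n → ℝ) × Us m n) : ℝ := ∑ j, ∑ k, |ω.1 j k| + nU m n ω.2

lemma goodU (m n : ℕ) : Good (muU m n) (nU m n) := good_std.prod ((good_std.pi m).prod (good_std.pi n))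
lemma goodW (m n : ℕ) : Good (muGU m n) (nW m n) := ((good_std.pi n).pi m).prod (goodU m n)

lemma sle {d : ℕ} (f : Fin d → ℝ) (hf : ∀ i, 0 ≤ f i) (i : Fin d) : f i ≤ ∑ i, f i :=
  Finset.single_le_sum (fun i _ => hf i) (Finset.mem_univ i)

lemma nU1 {m n : ℕ} (U : Us m n) : |U.1| ≤ nU m n U := by
  unfold nU; exact le_add_of_nonneg_right (by positivity)
lemma nU2 {m n : ℕ} (U : Us m n) (j : Fin m) : |U.2.1 j| ≤ nU m n U := by
  have := sle (fun j => |U.2.1 j|) (fun _ => abs_nonneg _) j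
  have h : 0 ≤ ∑ k, |U.2.2 k| := by positivity
  have := abs_nonneg U.1
  unfold nU; linarith
lemma nU3 {m n : ℕ} (U : Us m n) (j : Fin n) : |U.2.2 j| ≤ nU m n U := by
  have := sle (fun j => |U.2.2 j|) (fun _ => abs_nonneg _) j
  have h : 0 ≤ ∑ k, |U.2.1 k| := by positivity
  have := abs_nonneg U.1
  unfold nU; linarith
lemma nWU {m n : ℕ} (ω : (Fin m → Fin n → ℝ) × Us m n) : nU m n ω.2 ≤ nW m n ω := by
  unfold nW; exact le_add_of_nonneg_left (by positivity)
lemma nWG {m n : ℕ} (ω : (Fin m → Fin n → ℝ) × Us m n) (j k) : |ω.1 j k| ≤ nW m n ω := by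
  have h1 := sle (fun k => |ω.1 j k|) (fun _ => abs_nonneg _) k
  have h2 := sle (fun j => ∑ k, |ω.1 j k|) (fun _ => by positivity) j
  have := (goodU m n).nonneg ω.2
  unfold nW; linarith

lemma admL {m n : ℕ} {f : Us m n → ℝ} (hm : Measurable f) (h : ∀ U, |f U| ≤ nU m n U) :
    Adm (nU m n) (nW m n) (fun U _ => f U) :=
  ⟨hm.comp measurable_fst, 1, zero_le_one, fun a b => by
    have := h a
    have := (goodW m n).nonneg b
    linarith⟩
lemma admR {m n : ℕ} {f : (Fin m → Fin n → ℝ) × Us m n → ℝ} (hm : Measurable f) (h : ∀ U, |f U| ≤ nW m n U) :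
    Adm (nU m n) (nW m n) (fun _ b => f b) :=
  ⟨hm.comp measurable_snd, 1, zero_le_one, fun a b => by
    have := h b
    have := (goodU m n).nonneg a
    linarith⟩

lemma nrm2_ne {d : ℕ} {v : Fin d → ℝ} (h : v ≠ 0) : nrm2 v ≠ 0 := by
  unfold nrm2
  intro h0
  rw [Real.sqrt_eq_zero (by positivity), Finset.sum_eq_zero_iff_of_nonneg (fun _ _ => by positivity)] at h0
  exact h (funext fun i => by simpa using h0 i (Finset.mem_univ i))

lemma Tconv {m n l : ℕ} (hl : 1 ≤ l) (β s t m1 p0 p1 q0 q1 : ℝ) (x : Fin l → Fin n → ℝ) (y : Fin l → Fin m → ℝ)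
    (i1 i2 : Fin l) (f : Us m n → ((Fin m → Fin n → ℝ) × Us m n) → ℝ) :
    Tg (muU m n) (muGU m n) (fun U ω => LZ β s m1 (fun i j => D0 β s t m1 p0 p1 q0 q1 x y ω.1 U ω.2 i j))
      (fun U ω => wW β s (fun i j => D0 β s t m1 p0 p1 q0 q1 x y ω.1 U ω.2 i j) i1 i2 * f U ω) =
    ∫ ω, (∫ U1, Zq β s t m1 p0 p1 q0 q1 x y ω.1 U1 ω.2 ^ m1 ∂ muU m n)⁻¹ *
      (∫ U1, Zq β s t m1 p0 p1 q0 q1 x y ω.1 U1 ω.2 ^ (m1 - 1) *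
          Cq β s t m1 p0 p1 q0 q1 x y ω.1 U1 ω.2 i1 ^ (s - 1) *
          Aq β s t m1 p0 p1 q0 q1 x y ω.1 U1 ω.2 i1 i2 * f U1 ω ∂ muU m n) ∂ muGU m n := by
  unfold Tg
  simp only [exp_LZ_w hl]
  simp only [exp_LZ hl]
  rfl

theorem gen
    (m n l : ℕ) (hn : 1 ≤ n) (hl : 1 ≤ l)
    (β s t m1 p0 q0 : ℝ) (P Q : ℝ → ℝ) (r P' Q' : ℝ)
    (hPc : ContDiffAt ℝ 1 P r) (hQc : ContDiffAt ℝ 1 Q r) (hP : HasDerivAt P P' r) (hQ : HasDerivAt Q Q' r)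
    (hβ : 0 < β) (hs : s ≠ 0) (hm1 : 0 < m1)
    (x : Fin l → Fin n → ℝ) (y : Fin l → Fin m → ℝ)
    (hx : ∀ i, x i ≠ 0)
    (hp01 : P r < p0) (hp1pos : 0 < P r) (hq01 : Q r < q0) (hq1pos : 0 < Q r)
    (hpq : P r * Q r < p0 * q0) (hpqpos : 0 < P r * Q r) :
    HasDerivAt (fun ρ => psiq β s t m1 p0 (P ρ) q0 (Q ρ) x y)
      (Real.sign s / (2 * β * Real.sqrt (n : ℝ)) *
        ∑ i1, ∑ i2, β * nrm2 (x i1) *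
          ((P' * (Real.sqrt (1 - t) / Real.sqrt (P r) * ∑ j, Tp21 β s t m1 p0 (P r) q0 (Q r) x y j i1 i2)
            + Q' * (Real.sqrt (1 - t) / Real.sqrt (Q r) * nrm2 (y i2) * Tq22 β s t m1 p0 (P r) q0 (Q r) x y i1 i2)
              + Real.sqrt t * (P' * Q r + P r * Q') / Real.sqrt (P r * Q r) * nrm2 (y i2) * Tpq23 β s t m1 p0 (P r) q0 (Q r) x y i1 i2)
            - (P' * (Real.sqrt (1 - t) / Real.sqrt (p0 - P r) * ∑ j, Tp11 β s t m1 p0 (P r) q0 (Q r) x y j i1 i2)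
            + Q' * (Real.sqrt (1 - t) / Real.sqrt (q0 - Q r) * nrm2 (y i2) * Tq12 β s t m1 p0 (P r) q0 (Q r) x y i1 i2)
              + Real.sqrt t * (P' * Q r + P r * Q') / Real.sqrt (p0 * q0 - P r * Q r) * nrm2 (y i2) * Tpq13 β s t m1 p0 (P r) q0 (Q r) x y i1 i2))) r := by
  have g1 := goodU m n
  have g2 := goodW m n
  have n1 := g1.nonneg
  have n2 := g2.nonneg
  -- the building blocks
  have a1 : Adm (nU m n) (nW m n) (fun U _ => U.1) := admL measurable_fst nU1
  have a2 : Adm (nU m n) (nW m n) (fun _ ω => ω.2.1) :=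
    admR (f := fun ω => ω.2.1) (by fun_prop) (fun ω => (nU1 _).trans (nWU _))
  have b1 : ∀ j, Adm (nU m n) (nW m n) (fun U _ => U.2.1 j) := fun j =>
    admL (f := fun U => U.2.1 j) (by fun_prop) (fun U => nU2 U j)
  have b2 : ∀ j, Adm (nU m n) (nW m n) (fun _ ω => ω.2.2.1 j) := fun j =>
    admR (f := fun ω => ω.2.2.1 j) (by fun_prop) (fun ω => (nU2 _ j).trans (nWU _))
  have c1 : ∀ j, Adm (nU m n) (nW m n) (fun U _ => U.2.2 j) := fun j =>
    admL (f := fun U => U.2.2 j) (by fun_prop) (fun U => nU3 U j)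
  have c2 : ∀ j, Adm (nU m n) (nW m n) (fun _ ω => ω.2.2.2 j) := fun j =>
    admR (f := fun ω => ω.2.2.2 j) (by fun_prop) (fun ω => (nU3 _ j).trans (nWU _))
  have gg : ∀ j k, Adm (nU m n) (nW m n) (fun _ ω => ω.1 j k) := fun j k =>
    admR (f := fun ω => ω.1 j k) (by fun_prop) (fun ω => nWG _ j k)
  let E : Fin 6 → Fin l → Fin l → Us m n → ((Fin m → Fin n → ℝ) × Us m n) → ℝ := ![
    fun i1 i2 U ω => (Real.sqrt (1 - t) * nrm2 (x i1)) * ∑ j, y i2 j * U.2.1 j,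
    fun i1 i2 U ω => (Real.sqrt (1 - t) * nrm2 (x i1)) * ∑ j, y i2 j * ω.2.2.1 j,
    fun i1 i2 U ω => (Real.sqrt t * nrm2 (x i1) * nrm2 (y i2)) * U.1,
    fun i1 i2 U ω => (Real.sqrt t * nrm2 (x i1) * nrm2 (y i2)) * ω.2.1,
    fun i1 i2 U ω => (Real.sqrt (1 - t) * nrm2 (y i2) * nrm2 (x i1)) * (dotv U.2.2 (x i1) / nrm2 (x i1)),
    fun i1 i2 U ω => (Real.sqrt (1 - t) * nrm2 (y i2) * nrm2 (x i1)) * (dotv ω.2.2.2 (x i1) / nrm2 (x i1))]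
  let c : Fin 6 → ℝ → ℝ := ![fun ρ => Real.sqrt (p0 - P ρ), fun ρ => Real.sqrt (P ρ),
    fun ρ => Real.sqrt (p0 * q0 - P ρ * Q ρ), fun ρ => Real.sqrt (P ρ * Q ρ),
    fun ρ => Real.sqrt (q0 - Q ρ), fun ρ => Real.sqrt (Q ρ)]
  have hd1 : ∀ i, Adm (nU m n) (nW m n) (fun U _ => dotv U.2.2 (x i) / nrm2 (x i)) := by
    intro i
    have := (Adm.sum n1 n2 Finset.univ fun k => (c1 k).cmul (x i k)).cmul (nrm2 (x i))⁻¹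
    refine (congrArg (Adm _ _) ?_).mp this
    ext U ω
    rw [dotv, div_eq_inv_mul]
    congr 1
    exact Finset.sum_congr rfl fun k _ => mul_comm _ _
  have hd2 : ∀ i, Adm (nU m n) (nW m n) (fun _ ω => dotv ω.2.2.2 (x i) / nrm2 (x i)) := by
    intro i
    have := (Adm.sum n1 n2 Finset.univ fun k => (c2 k).cmul (x i k)).cmul (nrm2 (x i))⁻¹
    refine (congrArg (Adm _ _) ?_).mp this
    ext U ω
    rw [dotv, div_eq_inv_mul]
    congr 1
    exact Finset.sum_congr rfl fun k _ => mul_comm _ _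
  have hE : ∀ k i j, Adm (nU m n) (nW m n) (E k i j) := by
    intro k i j
    fin_cases k
    · exact (Adm.sum n1 n2 Finset.univ fun k => (b1 k).cmul (y j k)).cmul _
    · exact (Adm.sum n1 n2 Finset.univ fun k => (b2 k).cmul (y j k)).cmul _
    · exact a1.cmul _
    · exact a2.cmul _
    · exact (hd1 i).cmul _
    · exact (hd2 i).cmul _
  have hc : ∀ k, ContDiffAt ℝ 1 (c k) r := by
    intro k
    fin_cases k
    · exact (contDiffAt_const.sub hPc).sqrt (sub_pos.2 hp01).ne'
    · exact hPc.sqrt hp1pos.ne'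
    · exact (contDiffAt_const.sub (hPc.mul hQc)).sqrt (sub_pos.2 hpq).ne'
    · exact (hPc.mul hQc).sqrt hpqpos.ne'
    · exact (contDiffAt_const.sub hQc).sqrt (sub_pos.2 hq01).ne'
    · exact hQc.sqrt hq1pos.ne'
  have d0 : deriv (c 0) r = -P' / (2 * Real.sqrt (p0 - P r)) :=
    ((hP.const_sub p0).sqrt (sub_pos.2 hp01).ne').deriv
  have d1 : deriv (c 1) r = P' / (2 * Real.sqrt (P r)) := (hP.sqrt hp1pos.ne').deriv
  have d2 : deriv (c 2) r = -(P' * Q r + P r * Q') / (2 * Real.sqrt (p0 * q0 - P r * Q r)) :=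
    (((hP.mul hQ).const_sub (p0 * q0)).sqrt (sub_pos.2 hpq).ne').deriv
  have d3 : deriv (c 3) r = (P' * Q r + P r * Q') / (2 * Real.sqrt (P r * Q r)) :=
    ((hP.mul hQ).sqrt hpqpos.ne').deriv
  have d4 : deriv (c 4) r = -Q' / (2 * Real.sqrt (q0 - Q r)) :=
    ((hQ.const_sub q0).sqrt (sub_pos.2 hq01).ne').deriv
  have d5 : deriv (c 5) r = Q' / (2 * Real.sqrt (Q r)) := (hQ.sqrt hq1pos.ne').deriv
  obtain ⟨hΦA, hWA, hder⟩ := core g1 g2 hl β s m1 hc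
    (fun i j U ω => Real.sqrt t * (∑ a, ∑ b, y j a * (ω.1 a b * x i b))) E
    (fun i j => by
      have := (Adm.sum n1 n2 Finset.univ fun a => Adm.sum n1 n2 Finset.univ fun b =>
        (gg a b).cmul (y j a * x i b)).cmul (Real.sqrt t)
      refine (congrArg (Adm _ _) ?_).mp this
      ext U ω
      congr 1
      exact Finset.sum_congr rfl fun a _ => Finset.sum_congr rfl fun b _ => by ring) hE
    (fun ρ i j U ω => D0 β s t m1 p0 (P ρ) q0 (Q ρ) x y ω.1 U ω.2 i j) (by
      intro ρ i j U ω
      have hxi := nrm2_ne (hx i)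
      rw [Fin.sum_univ_six]
      simp only [c, E, D0, dotv, Matrix.cons_val]
      have e1 : ∑ a, y j a * (Real.sqrt (p0 - P ρ) * U.2.1 a + Real.sqrt (P ρ) * ω.2.2.1 a) =
          Real.sqrt (p0 - P ρ) * (∑ a, y j a * U.2.1 a) + Real.sqrt (P ρ) * ∑ a, y j a * ω.2.2.1 a := by
        rw [Finset.mul_sum, Finset.mul_sum, ← Finset.sum_add_distrib]
        exact Finset.sum_congr rfl fun a _ => by ring
      have e2 : ∑ a, (Real.sqrt (q0 - Q ρ) * U.2.2 a + Real.sqrt (Q ρ) * ω.2.2.2 a) * x i a =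
          Real.sqrt (q0 - Q ρ) * (∑ a, U.2.2 a * x i a) + Real.sqrt (Q ρ) * ∑ a, ω.2.2.2 a * x i a := by
        rw [Finset.mul_sum, Finset.mul_sum, ← Finset.sum_add_distrib]
        exact Finset.sum_congr rfl fun a _ => by ring
      rw [e1, e2]
      field_simp
      ring)
  have hder2 := hder.const_mul (β * |s| * Real.sqrt (n : ℝ) * m1)⁻¹
  have hfun : (fun ρ => psiq β s t m1 p0 (P ρ) q0 (Q ρ) x y) = fun ρ => (β * |s| * Real.sqrt (n : ℝ) * m1)⁻¹ *
      ∫ ω, Real.log (∫ U, Real.exp (LZ β s m1 (fun i j => D0 β s t m1 p0 (P ρ) q0 (Q ρ) x y ω.1 U ω.2 i j)) ∂muU m n) ∂muGU m n := by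
    ext ρ
    rw [← integral_const_mul]
    simp only [exp_LZ hl]
    rfl
  rw [hfun]
  refine hder2.congr_deriv ?_
  have key : ∀ i1 i2 : Fin l,
      ∑ k, deriv (c k) r *
        Tg (muU m n) (muGU m n) (fun U ω => LZ β s m1 (fun i j => D0 β s t m1 p0 (P r) q0 (Q r) x y ω.1 U ω.2 i j))
          (fun U ω => wW β s (fun i j => D0 β s t m1 p0 (P r) q0 (Q r) x y ω.1 U ω.2 i j) i1 i2 * E k i1 i2 U ω) =
      1 / 2 * (nrm2 (x i1) *
          ((P' * (Real.sqrt (1 - t) / Real.sqrt (P r) * ∑ j, Tp21 β s t m1 p0 (P r) q0 (Q r) x y j i1 i2)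
            + Q' * (Real.sqrt (1 - t) / Real.sqrt (Q r) * nrm2 (y i2) * Tq22 β s t m1 p0 (P r) q0 (Q r) x y i1 i2)
              + Real.sqrt t * (P' * Q r + P r * Q') / Real.sqrt (P r * Q r) * nrm2 (y i2) * Tpq23 β s t m1 p0 (P r) q0 (Q r) x y i1 i2)
            - (P' * (Real.sqrt (1 - t) / Real.sqrt (p0 - P r) * ∑ j, Tp11 β s t m1 p0 (P r) q0 (Q r) x y j i1 i2)
            + Q' * (Real.sqrt (1 - t) / Real.sqrt (q0 - Q r) * nrm2 (y i2) * Tq12 β s t m1 p0 (P r) q0 (Q r) x y i1 i2)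
              + Real.sqrt t * (P' * Q r + P r * Q') / Real.sqrt (p0 * q0 - P r * Q r) * nrm2 (y i2) * Tpq13 β s t m1 p0 (P r) q0 (Q r) x y i1 i2))) := by
    intro i1 i2
    have pull : ∀ (C : ℝ) (f : Us m n → ((Fin m → Fin n → ℝ) × Us m n) → ℝ),
        Tg (muU m n) (muGU m n) (fun U ω => LZ β s m1 (fun i j => D0 β s t m1 p0 (P r) q0 (Q r) x y ω.1 U ω.2 i j))
          (fun U ω => wW β s (fun i j => D0 β s t m1 p0 (P r) q0 (Q r) x y ω.1 U ω.2 i j) i1 i2 * (C * f U ω)) =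
        C * Tg (muU m n) (muGU m n) (fun U ω => LZ β s m1 (fun i j => D0 β s t m1 p0 (P r) q0 (Q r) x y ω.1 U ω.2 i j))
          (fun U ω => wW β s (fun i j => D0 β s t m1 p0 (P r) q0 (Q r) x y ω.1 U ω.2 i j) i1 i2 * f U ω) := by
      intro C f
      rw [← Tg_cmul]
      congr 1
      ext U ω
      ring
    have psum : ∀ (f : Fin m → Us m n → ((Fin m → Fin n → ℝ) × Us m n) → ℝ), (∀ j, Adm (nU m n) (nW m n) (f j)) →
        Tg (muU m n) (muGU m n) (fun U ω => LZ β s m1 (fun i j => D0 β s t m1 p0 (P r) q0 (Q r) x y ω.1 U ω.2 i j))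
          (fun U ω => wW β s (fun i j => D0 β s t m1 p0 (P r) q0 (Q r) x y ω.1 U ω.2 i j) i1 i2 * ∑ j, f j U ω) =
        ∑ j, Tg (muU m n) (muGU m n) (fun U ω => LZ β s m1 (fun i j => D0 β s t m1 p0 (P r) q0 (Q r) x y ω.1 U ω.2 i j))
          (fun U ω => wW β s (fun i j => D0 β s t m1 p0 (P r) q0 (Q r) x y ω.1 U ω.2 i j) i1 i2 * f j U ω) := by
      intro f hf
      simp only [Finset.mul_sum]
      exact Tg_sum g1 g2 hΦA _ (fun j => hWA i1 i2 _ (hf j))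
    rw [Fin.sum_univ_six, d0, d1, d2, d3, d4, d5]
    simp only [E, Matrix.cons_val]
    rw [pull, pull, pull _ (fun U ω => U.1), pull _ (fun U ω => ω.2.1),
      pull _ (fun U ω => dotv U.2.2 (x i1) / nrm2 (x i1)), pull _ (fun U ω => dotv ω.2.2.2 (x i1) / nrm2 (x i1)),
      psum _ (fun j => (b1 j).cmul (y i2 j)), psum _ (fun j => (b2 j).cmul (y i2 j))]
    simp only [Tconv hl]
    have t1 : ∀ j, Tp11 β s t m1 p0 (P r) q0 (Q r) x y j i1 i2 = _ := fun j => by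
      unfold Tp11
      simp only [mul_assoc (_ * _ * _) (y i2 j)]
      rfl
    have t2 : ∀ j, Tp21 β s t m1 p0 (P r) q0 (Q r) x y j i1 i2 = _ := fun j => by
      unfold Tp21
      simp only [mul_assoc (_ * _ * _) (y i2 j)]
      rfl
    simp only [t1, t2]
    unfold Tq12 Tq22 Tpq13 Tpq23
    ring
  simp only [key]
  have hsg : Real.sign s = s / |s| := by
    rcases lt_or_gt_of_ne hs with h | h
    · rw [Real.sign_of_neg h, abs_of_neg h, div_neg, div_self hs]
    · rw [Real.sign_of_pos h, abs_of_pos h, div_self hs]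
  have hsn : Real.sqrt (n:ℝ) ≠ 0 := (Real.sqrt_pos.2 (by exact_mod_cast hn)).ne'
  have hsa : |s| ≠ 0 := abs_ne_zero.2 hs
  rw [hsg]
  have comb : ∀ (N : Fin l → ℝ) (H : Fin l → Fin l → ℝ),
      (β * |s| * Real.sqrt (n : ℝ) * m1)⁻¹ * (m1 * s * β * ∑ i1, ∑ i2, 1 / 2 * (N i1 * H i1 i2)) =
      s / |s| / (2 * β * Real.sqrt (n : ℝ)) * ∑ i1, ∑ i2, β * N i1 * H i1 i2 := by
    intro N H
    simp only [Finset.mul_sum]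
    refine Finset.sum_congr rfl fun i _ => Finset.sum_congr rfl fun j _ => ?_
    field_simp
  exact comb _ _
end conc
end Aux

/-- First-level derivative decomposition of `ψ` with respect to `p₁` and `q₁`. -/
theorem first_level_derivative_decomposition
    (m n l : ℕ) (hm : 1 ≤ m) (hn : 1 ≤ n) (hl : 1 ≤ l)
    (β s t m1 p0 p1 q0 q1 : ℝ)
    (hβ : 0 < β) (hs : s ≠ 0) (ht : t ∈ Set.Ioo (0:ℝ) 1) (hm1 : m1 ∈ Set.Ioc (0:ℝ) 1)
    (hp : p1 ≤ p0) (hp1 : 0 ≤ p1) (hq : q1 ≤ q0) (hq1 : 0 ≤ q1)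
    (x : Fin l → Fin n → ℝ) (y : Fin l → Fin m → ℝ)
    (hx : ∀ i, x i ≠ 0) (hy : ∀ i, y i ≠ 0)
    (hp01 : p1 < p0) (hp1pos : 0 < p1) (hq01 : q1 < q0) (hq1pos : 0 < q1)
    (hpq : p1 * q1 < p0 * q0) (hpqpos : 0 < p1 * q1) :
    HasDerivAt (fun ρ => psiq β s t m1 p0 ρ q0 q1 x y)
      (Real.sign s / (2 * β * Real.sqrt (n : ℝ)) *
        ∑ i1, ∑ i2, β * nrm2 (x i1) *
          ((Real.sqrt (1 - t) / Real.sqrt p1 * ∑ j, Tp21 β s t m1 p0 p1 q0 q1 x y j i1 i2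
              + Real.sqrt t * q1 / Real.sqrt (p1 * q1) * nrm2 (y i2) * Tpq23 β s t m1 p0 p1 q0 q1 x y i1 i2)
            - (Real.sqrt (1 - t) / Real.sqrt (p0 - p1) * ∑ j, Tp11 β s t m1 p0 p1 q0 q1 x y j i1 i2
              + Real.sqrt t * q1 / Real.sqrt (p0 * q0 - p1 * q1) * nrm2 (y i2) * Tpq13 β s t m1 p0 p1 q0 q1 x y i1 i2))) p1
    ∧
    HasDerivAt (fun ρ => psiq β s t m1 p0 p1 q0 ρ x y)
      (Real.sign s / (2 * β * Real.sqrt (n : ℝ)) *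
        ∑ i1, ∑ i2, β * nrm2 (x i1) *
          ((Real.sqrt (1 - t) / Real.sqrt q1 * nrm2 (y i2) * Tq22 β s t m1 p0 p1 q0 q1 x y i1 i2
              + Real.sqrt t * p1 / Real.sqrt (p1 * q1) * nrm2 (y i2) * Tpq23 β s t m1 p0 p1 q0 q1 x y i1 i2)
            - (Real.sqrt (1 - t) / Real.sqrt (q0 - q1) * nrm2 (y i2) * Tq12 β s t m1 p0 p1 q0 q1 x y i1 i2
              + Real.sqrt t * p1 / Real.sqrt (p0 * q0 - p1 * q1) * nrm2 (y i2) * Tpq13 β s t m1 p0 p1 q0 q1 x y i1 i2))) q1 := by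
  constructor
  · have h := Aux.gen m n l hn hl β s t m1 p0 q0 (fun ρ => ρ) (fun _ => q1) p1 1 0 contDiffAt_id contDiffAt_const
      (hasDerivAt_id p1) (hasDerivAt_const p1 q1) hβ hs hm1.1 x y hx hp01 hp1pos hq01 hq1pos hpq hpqpos
    simpa using h
  · have h := Aux.gen m n l hn hl β s t m1 p0 q0 (fun _ => p1) (fun ρ => ρ) q1 0 1 contDiffAt_const contDiffAt_id
      (hasDerivAt_const q1 p1) (hasDerivAt_id q1) hβ hs hm1.1 x y hx hp01 hp1pos hq01 hq1pos hpq hpqpos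
    simpa using h

end

end SFL
end

section
/- Proposition 1 (first-level p,q-derivatives): in the first-level interpolating setup, assume additionally p₀ > p₁ > 0, q₀ > q₁ > 0 and p₀q₀ > p₁q₁ > 0. Then dψ(X,Y,p,q,𝔪,β,s,t)/dp₁ = −(sign(s) s β 𝔪₁/(2√n)) [ (1−t) E_{G,𝒰₂}⟨‖x^{(i₁)}‖₂‖x^{(p₁)}‖₂ (y^{(p₂)})ᵀy^{(i₂)}⟩_{γ₂^{(1)}} + t q₁ E_{G,𝒰₂}⟨‖x^{(i₁)}‖₂‖x^{(p₁)}‖₂‖y^{(i₂)}‖₂‖y^{(p₂)}‖₂⟩_{γ₂^{(1)}} ], and dψ(X,Y,p,q,𝔪,β,s,t)/dq₁ = −(sign(s) s β 𝔪₁/(2√n)) [ (1−t) E_{G,𝒰₂}⟨‖y^{(i₂)}‖₂‖y^{(p₂)}‖₂ (x^{(p₁)})ᵀx^{(i₁)}⟩_{γ₂^{(1)}} + t p₁ E_{G,𝒰₂}⟨‖x^{(i₁)}‖₂‖x^{(p₁)}‖₂‖y^{(i₂)}‖₂‖y^{(p₂)}‖₂⟩_{γ₂^{(1)}} ]. -/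
set_option linter.unusedVariables false

open MeasureTheory Real

namespace SFL

noncomputable section

variable {m n l : ℕ}

/-- Gaussian integration by parts property of a measure in direction `e` w.r.t. functional `ξ`. -/
def IBP {E : Type} [AddCommGroup E] [Module ℝ E] [MeasurableSpace E] (μ : Measure E) (e : E)
    (ξ : E → ℝ) : Prop :=
  ∀ f f' : E → ℝ, (∀ u, HasDerivAt (fun r : ℝ => f (u + r • e)) (f' u) 0) →
    Integrable f μ → Integrable f' μ → Integrable (fun u => ξ u * f u) μ →
    ∫ u, ξ u * f u ∂μ = ∫ u, f' u ∂μ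

instance : IsProbabilityMeasure stdG := by unfold stdG; infer_instance
instance (d : ℕ) : IsProbabilityMeasure (gVec d) := by unfold gVec; infer_instance
instance (m n : ℕ) : IsProbabilityMeasure (gMat m n) := by unfold gMat; infer_instance
instance (m n : ℕ) : IsProbabilityMeasure (muU m n) := by unfold muU; infer_instance
instance (m n : ℕ) : IsProbabilityMeasure (muGU m n) := by unfold muGU; infer_instance

lemma integrable_stdG_iff (f : ℝ → ℝ) :
    Integrable f stdG ↔ Integrable (fun x => ProbabilityTheory.gaussianPDFReal 0 1 x * f x) := by
  unfold stdG
  rw [ProbabilityTheory.gaussianReal_of_var_ne_zero _ one_ne_zero,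
    integrable_withDensity_iff_integrable_smul' (ProbabilityTheory.measurable_gaussianPDF 0 1)
      (Filter.Eventually.of_forall fun x => ProbabilityTheory.gaussianPDF_lt_top)]
  simp [ProbabilityTheory.toReal_gaussianPDF]

lemma hasDerivAt_pdf (x : ℝ) : HasDerivAt (ProbabilityTheory.gaussianPDFReal 0 1)
    (-(x * ProbabilityTheory.gaussianPDFReal 0 1 x)) x := by
  unfold ProbabilityTheory.gaussianPDFReal
  have h : HasDerivAt (fun x : ℝ => -(x - 0) ^ 2 / (2 * ((1 : NNReal) : ℝ))) (-x) x := by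
    have := ((((hasDerivAt_id x).sub_const 0).pow 2).neg).div_const (2 * ((1 : NNReal) : ℝ))
    refine this.congr_deriv ?_
    simp
    ring
  refine (h.exp.const_mul _).congr_deriv ?_
  simp
  ring

lemma ibp_stdG : IBP stdG (1 : ℝ) (fun u => u) := by
  intro f f' hd hf hf' hxf
  have hd' : ∀ x, HasDerivAt f (f' x) x := by
    intro x
    have h := hd x
    have h2 : HasDerivAt (fun z : ℝ => z - x) 1 x := (hasDerivAt_id x).sub_const x
    have h3 : HasDerivAt (fun r : ℝ => f (x + r • (1:ℝ))) (f' x) (x - x) := by simpa using h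
    have := HasDerivAt.comp (h₂ := fun r : ℝ => f (x + r • (1:ℝ))) (h := fun z => z - x) x h3 h2
    simpa [Function.comp_def] using this
  rw [integrable_stdG_iff] at hf hf' hxf
  have := integral_mul_deriv_eq_deriv_mul_of_integrable (u := f)
    (v := ProbabilityTheory.gaussianPDFReal 0 1) (u' := f')
    (v' := fun x => -(x * ProbabilityTheory.gaussianPDFReal 0 1 x))
    (fun x _ => hd' x) (fun x _ => hasDerivAt_pdf x)
    (hxf.neg.congr (.of_forall fun x => by simp; ring)) (hf'.congr (.of_forall fun x => by simp; ring))
    (hf.congr (.of_forall fun x => by simp; ring))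
  unfold stdG
  rw [ProbabilityTheory.integral_gaussianReal_eq_integral_smul one_ne_zero,
    ProbabilityTheory.integral_gaussianReal_eq_integral_smul one_ne_zero]
  rw [← neg_inj, ← integral_neg]
  refine Eq.trans ?_ (this.trans ?_)
  · congr 1; ext x; simp; ring
  · congr 2; ext x; simp; ring

lemma ibp_prod_left {E F : Type} [AddCommGroup E] [Module ℝ E] [MeasurableSpace E]
    [AddCommGroup F] [Module ℝ F] [MeasurableSpace F] (μ : Measure E) (ν : Measure F)
    [IsProbabilityMeasure μ] [IsProbabilityMeasure ν] (e : E) (ξ : E → ℝ) (h : IBP μ e ξ) :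
    IBP (μ.prod ν) (e, (0:F)) (fun u => ξ u.1) := by
  intro f f' hd hf hf' hxf
  rw [integral_prod_symm _ hxf, integral_prod_symm _ hf']
  apply integral_congr_ae
  filter_upwards [hf.prod_left_ae, hf'.prod_left_ae, hxf.prod_left_ae] with b h1 h2 h3
  exact h (fun a => f (a, b)) (fun a => f' (a, b)) (fun u => by simpa using hd (u, b)) h1 h2 h3

lemma ibp_prod_right {E F : Type} [AddCommGroup E] [Module ℝ E] [MeasurableSpace E]
    [AddCommGroup F] [Module ℝ F] [MeasurableSpace F] (μ : Measure E) (ν : Measure F)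
    [IsProbabilityMeasure μ] [IsProbabilityMeasure ν] (e : F) (ξ : F → ℝ) (h : IBP ν e ξ) :
    IBP (μ.prod ν) ((0:E), e) (fun u => ξ u.2) := by
  intro f f' hd hf hf' hxf
  rw [integral_prod _ hxf, integral_prod _ hf']
  apply integral_congr_ae
  filter_upwards [hf.prod_right_ae, hf'.prod_right_ae, hxf.prod_right_ae] with a h1 h2 h3
  exact h (fun b => f (a, b)) (fun b => f' (a, b)) (fun u => by simpa using hd (a, u)) h1 h2 h3

lemma ibp_gVec (d : ℕ) (k : Fin d) : IBP (gVec d) (Pi.single k (1:ℝ)) (fun u => u k) := by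
  obtain ⟨d, rfl⟩ : ∃ d', d = d' + 1 := ⟨d - 1, by have := k.2; omega⟩
  intro f f' hd hf hf' hxf
  have mp := (measurePreserving_piFinSuccAbove (fun _ : Fin (d+1) => stdG) k).symm
  have key := ibp_prod_left stdG (gVec d) 1 (fun u => u) ibp_stdG
  unfold gVec at *
  rw [← mp.integral_comp' , ← mp.integral_comp']
  rw [← mp.integrable_comp_emb (MeasurableEquiv.measurableEmbedding _)] at hf hf' hxf
  have := key _ _ ?_ hf hf' (by convert hxf using 2; simp [Function.comp_def])
  · refine Eq.trans ?_ this
    congr 1; ext z; simp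
  · intro u
    refine HasDerivAt.congr_of_eventuallyEq (hd ((MeasurableEquiv.piFinSuccAbove (fun _ => ℝ) k).symm u)) (.of_forall fun r => ?_)
    simp [MeasurableEquiv.piFinSuccAbove_symm_apply, Fin.insertNthEquiv]
    congr 1
    ext j
    refine Fin.succAboveCases k ?_ (fun j => ?_) j <;> simp [Fin.succAbove_ne]

lemma integrable_exp_abs_stdG (K : ℝ) : Integrable (fun x => exp (K * |x|)) stdG := by
  have h1 := (ProbabilityTheory.integrable_exp_mul_gaussianReal (μ := 0) (v := 1) K)
  have h2 := (ProbabilityTheory.integrable_exp_mul_gaussianReal (μ := 0) (v := 1) (-K))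
  refine (h1.add h2).mono' (by fun_prop) (Filter.Eventually.of_forall fun x => ?_)
  simp only [norm_eq_abs, abs_exp, Pi.add_apply]
  rcases abs_cases x with ⟨h, _⟩ | ⟨h, _⟩ <;> rw [h]
  · linarith [exp_pos (-K * x)]
  · have : K * -x = -K * x := by ring
    rw [this]; linarith [exp_pos (K * x)]

lemma integrable_exp_gVec (d : ℕ) (K : ℝ) :
    Integrable (fun u => exp (K * ∑ i, |u i|)) (gVec d) := by
  unfold gVec
  have := Integrable.fintype_prod (μ := fun _ : Fin d => stdG) (f := fun _ x => exp (K * |x|))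
    (fun _ => integrable_exp_abs_stdG K)
  simpa [Finset.mul_sum, exp_sum] using this

lemma integrable_exp_gMat (m n : ℕ) (K : ℝ) :
    Integrable (fun G => exp (K * ∑ j, ∑ k, |G j k|)) (gMat m n) := by
  unfold gMat
  have := Integrable.fintype_prod (μ := fun _ : Fin m => gVec n)
    (E := Fin n → ℝ) (𝕜 := ℝ) (f := fun (_ : Fin m) (x : Fin n → ℝ) => exp (K * ∑ i, |x i|)) (fun _ => integrable_exp_gVec n K)
  simpa [Finset.mul_sum, exp_sum] using this

/-- ℓ¹ size of a group of variables. -/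
def RU (u : Us m n) : ℝ := |u.1| + (∑ j, |u.2.1 j| + ∑ k, |u.2.2 k|)

/-- ℓ¹ size of the outer variables. -/
def RW (w : (Fin m → Fin n → ℝ) × Us m n) : ℝ := (∑ j, ∑ k, |w.1 j k|) + RU w.2

lemma integrable_exp_RU (K : ℝ) : Integrable (fun u => exp (K * RU u)) (muU m n) := by
  unfold muU
  have := (integrable_exp_abs_stdG K).mul_prod
    ((integrable_exp_gVec m K).mul_prod (integrable_exp_gVec n K))
  simpa [RU, mul_add, exp_add] using this

lemma integrable_exp_RW (K : ℝ) : Integrable (fun u => exp (K * RW u)) (muGU m n) := by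
  unfold muGU
  have := (integrable_exp_gMat m n K).mul_prod (integrable_exp_RU (m := m) (n := n) K)
  simpa [RW, mul_add, exp_add] using this

/-- coordinate index type -/
abbrev Kx (m n : ℕ) : Type := Unit ⊕ Fin m ⊕ Fin n

/-- coordinates -/
def xi (k : Kx m n) (u : Us m n) : ℝ :=
  match k with
  | .inl _ => u.1
  | .inr (.inl j) => u.2.1 j
  | .inr (.inr j) => u.2.2 j

/-- basis vectors -/
def eb (k : Kx m n) : Us m n :=
  match k with
  | .inl _ => (1, 0, 0)
  | .inr (.inl j) => (0, Pi.single j 1, 0)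
  | .inr (.inr j) => (0, 0, Pi.single j 1)

lemma continuous_xi (k : Kx m n) : Continuous (xi k) := by
  rcases k with _ | j | j <;> unfold xi <;> fun_prop

lemma RU_nonneg (u : Us m n) : 0 ≤ RU u := by unfold RU; positivity

lemma RW_nonneg (u : (Fin m → Fin n → ℝ) × Us m n) : 0 ≤ RW u := by
  have := RU_nonneg u.2
  unfold RW; positivity

lemma continuous_RU : Continuous (RU (m := m) (n := n)) := by unfold RU; fun_prop

lemma abs_xi_le (k : Kx m n) (u : Us m n) : |xi k u| ≤ RU u := by
  have h1 : 0 ≤ ∑ j, |u.2.1 j| := by positivity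
  have h2 : 0 ≤ ∑ j, |u.2.2 j| := by positivity
  have h3 : 0 ≤ |u.1| := by positivity
  rcases k with _ | j | j <;> unfold xi RU
  · simp only; linarith
  · simp only
    have := Finset.single_le_sum (f := fun j => |u.2.1 j|) (fun i _ => abs_nonneg _) (Finset.mem_univ j)
    linarith
  · simp only
    have := Finset.single_le_sum (f := fun j => |u.2.2 j|) (fun i _ => abs_nonneg _) (Finset.mem_univ j)
    linarith

lemma xi_add (k k' : Kx m n) (u : Us m n) (r : ℝ) :
    xi k (u + r • eb k') = xi k u + r * (if k = k' then 1 else 0) := by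
  rcases k with _ | j | j <;> rcases k' with _ | j' | j' <;> simp [xi, eb, Pi.single_apply]

lemma ibp_muU (k : Kx m n) : IBP (muU m n) (eb k) (xi k) := by
  unfold muU
  rcases k with _ | j | j
  · exact ibp_prod_left _ _ _ _ ibp_stdG
  · exact ibp_prod_right _ _ _ _ (ibp_prod_left _ _ _ _ (ibp_gVec m j))
  · exact ibp_prod_right _ _ _ _ (ibp_prod_right _ _ _ _ (ibp_gVec n j))

lemma ibp_muGU (k : Kx m n) : IBP (muGU m n) (0, eb k) (fun w => xi k w.2) :=
  ibp_prod_right _ _ _ _ (ibp_muU k)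


/-- linear growth -/
def LB {α : Type} (s : Set α) (R : α → ℝ) (f : α → ℝ) : Prop :=
  ∃ C : ℝ, 0 ≤ C ∧ ∀ a ∈ s, |f a| ≤ C * (1 + R a)

/-- exponential growth -/
def EBd {α : Type} (s : Set α) (R : α → ℝ) (f : α → ℝ) : Prop :=
  ∃ C : ℝ, 0 ≤ C ∧ ∀ a ∈ s, |f a| ≤ exp (C * (1 + R a))

section growth
variable {α : Type} {s : Set α} {R : α → ℝ}

lemma LB.const (hR : ∀ a, 0 ≤ R a) (c : ℝ) : LB s R (fun _ => c) :=
  ⟨|c|, abs_nonneg c, fun a _ => by nlinarith [hR a, abs_nonneg c]⟩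

lemma LB.add {f g : α → ℝ} (hf : LB s R f) (hg : LB s R g) : LB s R (fun a => f a + g a) := by
  obtain ⟨C, hC, h⟩ := hf
  obtain ⟨D, hD, h'⟩ := hg
  exact ⟨C + D, by positivity, fun a ha => (abs_add_le _ _).trans (by
    have := h a ha; have := h' a ha; linarith)⟩

lemma LB.sum {ι : Type} (t : Finset ι) {f : ι → α → ℝ} (hR : ∀ a, 0 ≤ R a)
    (hf : ∀ i, LB s R (f i)) : LB s R (fun a => ∑ i ∈ t, f i a) := by
  classical
  induction t using Finset.induction_on with
  | empty => simpa using LB.const hR 0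
  | insert i t hi ih => simp only [Finset.sum_insert hi]; exact (hf i).add ih

lemma LB.bmul {f c : α → ℝ} {B : ℝ} (hc : ∀ a ∈ s, |c a| ≤ B)
    (hf : LB s R f) : LB s R (fun a => c a * f a) := by
  obtain ⟨C, hC, h⟩ := hf
  refine ⟨|B| * C, by positivity, fun a ha => ?_⟩
  rw [abs_mul, mul_assoc]
  exact mul_le_mul ((hc a ha).trans (le_abs_self _)) (h a ha) (abs_nonneg _) (abs_nonneg _)

lemma LB.abs {f : α → ℝ} (hf : LB s R f) : LB s R (fun a => |f a|) := by
  simpa [LB] using hf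

lemma LB.toE {f : α → ℝ} (hf : LB s R f) : EBd s R f := by
  obtain ⟨C, hC, h⟩ := hf
  exact ⟨C, hC, fun a ha => (h a ha).trans (by linarith [add_one_le_exp (C * (1 + R a))])⟩

lemma EBd.mul {f g : α → ℝ} (hf : EBd s R f) (hg : EBd s R g) : EBd s R (fun a => f a * g a) := by
  obtain ⟨C, hC, h⟩ := hf
  obtain ⟨D, hD, h'⟩ := hg
  refine ⟨C + D, by positivity, fun a ha => ?_⟩
  rw [abs_mul, add_mul, exp_add]
  exact mul_le_mul (h a ha) (h' a ha) (abs_nonneg _) (exp_pos _).le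

lemma EBd.add {f g : α → ℝ} (hR : ∀ a, 0 ≤ R a) (hf : EBd s R f) (hg : EBd s R g) :
    EBd s R (fun a => f a + g a) := by
  obtain ⟨C, hC, h⟩ := hf
  obtain ⟨D, hD, h'⟩ := hg
  refine ⟨C + D + 1, by positivity, fun a ha => (abs_add_le _ _).trans ?_⟩
  have h1 := h a ha
  have h2 := h' a ha
  have hRa := hR a
  have e1 : exp (C * (1 + R a)) ≤ exp ((C + D) * (1 + R a)) := exp_le_exp.2 (by nlinarith)
  have e2 : exp (D * (1 + R a)) ≤ exp ((C + D) * (1 + R a)) := exp_le_exp.2 (by nlinarith)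
  have e3 : 2 ≤ exp (1 + R a) := by linarith [add_one_le_exp (1 + R a)]
  have : exp ((C + D + 1) * (1 + R a)) = exp ((C + D) * (1 + R a)) * exp (1 + R a) := by
    rw [← exp_add]; congr 1; ring
  rw [this]
  nlinarith [exp_pos ((C + D) * (1 + R a))]

lemma EBd.const (hR : ∀ a, 0 ≤ R a) (c : ℝ) : EBd s R (fun _ => c) := (LB.const hR c).toE

lemma EBd.sum {ι : Type} (t : Finset ι) {f : ι → α → ℝ} (hR : ∀ a, 0 ≤ R a)
    (hf : ∀ i, EBd s R (f i)) : EBd s R (fun a => ∑ i ∈ t, f i a) := by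
  classical
  induction t using Finset.induction_on with
  | empty => simpa using EBd.const hR 0
  | insert i t hi ih => simp only [Finset.sum_insert hi]; exact (hf i).add hR ih

lemma EBd.mono_abs {f g : α → ℝ} (hf : EBd s R f) (h : ∀ a ∈ s, |g a| ≤ |f a|) : EBd s R g := by
  obtain ⟨C, hC, h'⟩ := hf
  exact ⟨C, hC, fun a ha => (h a ha).trans (h' a ha)⟩

lemma EBd.integral (hR : ∀ a, 0 ≤ R a) {f : α → Us m n → ℝ}
    (hf : EBd (s ×ˢ Set.univ) (fun p => R p.1 + RU p.2) (fun p : α × Us m n => f p.1 p.2)) :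
    EBd s R (fun a => ∫ U, f a U ∂ muU m n) := by
  obtain ⟨C, hC, h⟩ := hf
  set c := ∫ U, exp (C * RU U) ∂ muU m n
  have hc : 0 < c := integral_exp_pos (integrable_exp_RU C)
  refine ⟨C + |log c|, by positivity, fun a ha => ?_⟩
  have h1 : |∫ U, f a U ∂ muU m n| ≤ ∫ U, exp (C * (1 + R a)) * exp (C * RU U) ∂ muU m n := by
    rw [← norm_eq_abs]
    refine norm_integral_le_of_norm_le ((integrable_exp_RU C).const_mul _) (.of_forall fun U => ?_)
    have := h (a, U) ⟨ha, trivial⟩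
    rw [← exp_add]
    refine this.trans (exp_le_exp.2 (le_of_eq ?_))
    simp only; ring
  rw [integral_const_mul] at h1
  refine h1.trans ?_
  change _ * c ≤ _
  conv_lhs => rw [← exp_log hc]
  rw [← exp_add]
  have hRa := hR a
  have : log c ≤ |log c| := le_abs_self _
  have := abs_nonneg (log c)
  exact exp_le_exp.2 (by nlinarith)

lemma EBd.inv_integral (hR : ∀ a, 0 ≤ R a) {f : α → Us m n → ℝ} (hpos : ∀ a U, 0 < f a U)
    (hint : ∀ a ∈ s, Integrable (f a) (muU m n))
    (hf : EBd (s ×ˢ Set.univ) (fun p => R p.1 + RU p.2) (fun p : α × Us m n => (f p.1 p.2)⁻¹)) :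
    EBd s R (fun a => (∫ U, f a U ∂ muU m n)⁻¹) := by
  obtain ⟨C, hC, h⟩ := hf
  set c := ∫ U, exp (-C * RU U) ∂ muU m n
  have hc : 0 < c := integral_exp_pos (integrable_exp_RU (-C))
  refine ⟨C + |log c|, by positivity, fun a ha => ?_⟩
  have h1 : exp (-C * (1 + R a)) * c ≤ ∫ U, f a U ∂ muU m n := by
    rw [← integral_const_mul]
    refine integral_mono ((integrable_exp_RU (-C)).const_mul _) (hint a ha) (fun U => ?_)
    have h2 := h (a, U) ⟨ha, trivial⟩
    simp only at h2
    rw [abs_of_pos (inv_pos.2 (hpos a U))] at h2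
    have h3 := inv_le_of_inv_le₀ (hpos a U) h2
    rw [← exp_neg] at h3
    simp only
    rw [← exp_add]
    refine le_trans (exp_le_exp.2 (le_of_eq ?_)) h3
    ring
  have h2 : 0 < exp (-C * (1 + R a)) * c := by positivity
  rw [abs_of_pos (inv_pos.2 (h2.trans_le h1))]
  refine (inv_anti₀ h2 h1).trans ?_
  conv_lhs => rw [← exp_log hc]
  rw [← exp_add, ← exp_neg]
  have hRa := hR a
  have : -log c ≤ |log c| := neg_le_abs _
  have := abs_nonneg (log c)
  exact exp_le_exp.2 (by nlinarith)

end growth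

lemma EBd.integrable_U {f : Us m n → ℝ} (hf : EBd Set.univ RU f)
    (hm : AEStronglyMeasurable f (muU m n)) : Integrable f (muU m n) := by
  obtain ⟨C, hC, h⟩ := hf
  refine ((integrable_exp_RU C).const_mul (exp C)).mono' hm (.of_forall fun U => ?_)
  rw [← exp_add]
  refine (h U trivial).trans (exp_le_exp.2 (le_of_eq (by ring)))

lemma EBd.integrable_W {f : (Fin m → Fin n → ℝ) × Us m n → ℝ} (hf : EBd Set.univ RW f)
    (hm : AEStronglyMeasurable f (muGU m n)) : Integrable f (muGU m n) := by
  obtain ⟨C, hC, h⟩ := hf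
  refine ((integrable_exp_RW C).const_mul (exp C)).mono' hm (.of_forall fun U => ?_)
  rw [← exp_add]
  refine (h U trivial).trans (exp_le_exp.2 (le_of_eq (by ring)))

/-- ℓ¹ norm -/
def SJ {J : Type} [Fintype J] (D : J → ℝ) : ℝ := ∑ i, |D i|

lemma EBd.comp {α J : Type} [Fintype J] {s : Set α} {R : α → ℝ} (hR : ∀ a, 0 ≤ R a)
    {H : (J → ℝ) → ℝ} (hH : EBd Set.univ SJ H) {D : α → J → ℝ} (hD : ∀ i, LB s R (fun a => D a i)) :
    EBd s R (fun a => H (D a)) := by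
  obtain ⟨C, hC, h⟩ := hH
  obtain ⟨C', hC', h'⟩ := LB.sum Finset.univ hR (fun i => (hD i).abs)
  refine ⟨C * (1 + C'), by positivity, fun a ha => (h _ trivial).trans (exp_le_exp.2 ?_)⟩
  have h1 := (le_abs_self _).trans (h' a ha)
  have hRa := hR a
  unfold SJ
  rw [mul_assoc]
  exact mul_le_mul_of_nonneg_left (by linarith) hC

/-- A continuously differentiable function given by coordinate partial derivatives. -/
structure CD {J : Type} [Fintype J] (H : (J → ℝ) → ℝ) (H1 : J → (J → ℝ) → ℝ) : Prop where
  cont : Continuous H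
  cont1 : ∀ i, Continuous (H1 i)
  chain : ∀ (D : ℝ → J → ℝ) (D' : J → ℝ) (r : ℝ),
    (∀ i, HasDerivAt (fun r => D r i) (D' i) r) →
    HasDerivAt (fun r => H (D r)) (∑ i, H1 i (D r) * D' i) r

lemma curve_deriv {J : Type} [Fintype J] {H : (J → ℝ) → ℝ} {H1 : J → (J → ℝ) → ℝ} (h : CD H H1)
    (eH : EBd Set.univ SJ H) (eH1 : ∀ i, EBd Set.univ SJ (H1 i))
    (D D' : ℝ → Us m n → J → ℝ) (r0 ε : ℝ) (hε : 0 < ε)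
    (hd : ∀ r ∈ Metric.ball r0 ε, ∀ U i, HasDerivAt (fun r => D r U i) (D' r U i) r)
    (lD : ∀ i, LB (Metric.ball r0 ε ×ˢ Set.univ) (fun p : ℝ × Us m n => RU p.2) (fun p => D p.1 p.2 i))
    (lD' : ∀ i, LB (Metric.ball r0 ε ×ˢ Set.univ) (fun p : ℝ × Us m n => RU p.2) (fun p => D' p.1 p.2 i))
    (cD : ∀ r, Continuous (D r)) (cD' : ∀ r, Continuous (D' r)) :
    HasDerivAt (fun r => ∫ U, H (D r U) ∂ muU m n)
      (∫ U, ∑ i, H1 i (D r0 U) * D' r0 U i ∂ muU m n) r0 := by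
  have hR : ∀ p : ℝ × Us m n, 0 ≤ RU p.2 := fun p => RU_nonneg _
  have e0 := EBd.comp hR eH lD
  have e1 : EBd (Metric.ball r0 ε ×ˢ Set.univ) (fun p : ℝ × Us m n => RU p.2)
      (fun p => ∑ i, H1 i (D p.1 p.2) * D' p.1 p.2 i) :=
    EBd.sum _ hR fun i => (EBd.comp hR (eH1 i) lD).mul (lD' i).toE
  have hc : ∀ r, Continuous (fun U => H (D r U)) := fun r => h.cont.comp (cD r)
  have hc1 : ∀ r, Continuous (fun U => ∑ i, H1 i (D r U) * D' r U i) := fun r =>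
    continuous_finsetSum _ fun i _ => ((h.cont1 i).comp (cD r)).mul
      ((continuous_apply i).comp (cD' r))
  obtain ⟨C, hC, hb⟩ := e1
  have hr0 : r0 ∈ Metric.ball r0 ε := Metric.mem_ball_self hε
  refine (hasDerivAt_integral_of_dominated_loc_of_deriv_le (s := Metric.ball r0 ε)
    (bound := fun U => exp (C * (1 + RU U)))
    (F' := fun r U => ∑ i, H1 i (D r U) * D' r U i) (Metric.ball_mem_nhds _ hε)
    (.of_forall fun r => (hc r).aestronglyMeasurable) ?_ (hc1 r0).aestronglyMeasurable
    (.of_forall fun U r hr => hb (r, U) ⟨hr, trivial⟩) ?_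
    (.of_forall fun U r hr => h.chain (fun r => D r U) (D' r U) r (hd r hr U))).2
  · refine EBd.integrable_U ?_ (hc r0).aestronglyMeasurable
    obtain ⟨C, hC, hb⟩ := e0
    exact ⟨C, hC, fun U _ => hb (r0, U) ⟨hr0, trivial⟩⟩
  · have := (integrable_exp_RU (m := m) (n := n) C).const_mul (exp C)
    refine this.congr (.of_forall fun U => ?_)
    simp only
    rw [← exp_add]; congr 1; ring


/-- Data of the abstract interpolation theorem. -/
structure Dat (m n : ℕ) (J : Type) [Fintype J] where
  F : (J → ℝ) → ℝ
  F1 : J → (J → ℝ) → ℝ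
  F2 : J → J → (J → ℝ) → ℝ
  g : J → (Fin m → Fin n → ℝ) → ℝ
  v : Kx m n → J → ℝ
  a : Kx m n → ℝ → ℝ
  a' : Kx m n → ℝ → ℝ
  b : Kx m n → ℝ → ℝ
  b' : Kx m n → ℝ → ℝ
  ρ0 : ℝ
  ε : ℝ
  hε : 0 < ε
  hF : CD F F1
  hF1 : ∀ i, CD (F1 i) (F2 i)
  pos : ∀ D, 0 < F D
  eF : EBd Set.univ SJ F
  eFi : EBd Set.univ SJ (fun D => (F D)⁻¹)
  eF1 : ∀ i, EBd Set.univ SJ (F1 i)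
  eF2 : ∀ i j, EBd Set.univ SJ (F2 i j)
  gc : ∀ i, Continuous (g i)
  gb : ∀ i, ∃ C : ℝ, 0 ≤ C ∧ ∀ G, |g i G| ≤ C * ∑ j, ∑ k, |G j k|
  ha : ∀ ρ ∈ Metric.ball ρ0 ε, ∀ k, HasDerivAt (a k) (a' k ρ) ρ
  hb : ∀ ρ ∈ Metric.ball ρ0 ε, ∀ k, HasDerivAt (b k) (b' k ρ) ρ
  bd : ∃ B, ∀ ρ ∈ Metric.ball ρ0 ε, ∀ k, |a k ρ| ≤ B ∧ |a' k ρ| ≤ B ∧ |b k ρ| ≤ B ∧ |b' k ρ| ≤ B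
  hab : ∀ k, a k ρ0 * a' k ρ0 = -(b k ρ0 * b' k ρ0)

namespace Dat
variable {J : Type} [Fintype J] (d : Dat m n J)

/-- outer sample space -/
abbrev Om (m n : ℕ) : Type := (Fin m → Fin n → ℝ) × Us m n

/-- the field -/
def T (ρ : ℝ) (ω : Om m n) (U : Us m n) (i : J) : ℝ :=
  d.g i ω.1 + ∑ k, d.v k i * (d.a k ρ * xi k U + d.b k ρ * xi k ω.2)

/-- derivative coefficient -/
def eta (ρ : ℝ) (ω : Om m n) (U : Us m n) (k : Kx m n) : ℝ :=
  d.a' k ρ * xi k U + d.b' k ρ * xi k ω.2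

/-- derivative of the field -/
def dT (ρ : ℝ) (ω : Om m n) (U : Us m n) (i : J) : ℝ := ∑ k, d.v k i * d.eta ρ ω U k

/-- parameter set -/
def ps : Set ((ℝ × Om m n) × Us m n) := (Metric.ball d.ρ0 d.ε ×ˢ Set.univ) ×ˢ Set.univ

/-- size -/
def RR (p : (ℝ × Om m n) × Us m n) : ℝ := RW p.1.2 + RU p.2

lemma RR_nonneg (p : (ℝ × Om m n) × Us m n) : 0 ≤ RR p := add_nonneg (RW_nonneg _) (RU_nonneg _)

lemma lb_xiU (k : Kx m n) (s : Set ((ℝ × Om m n) × Us m n)) : LB s RR (fun p => xi k p.2) :=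
  ⟨1, zero_le_one, fun p _ => by
    have := abs_xi_le k p.2; have := RW_nonneg p.1.2; unfold RR; linarith⟩

lemma lb_xiW (k : Kx m n) (s : Set ((ℝ × Om m n) × Us m n)) : LB s RR (fun p => xi k p.1.2.2) :=
  ⟨1, zero_le_one, fun p _ => by
    have := abs_xi_le k p.1.2.2; have := RU_nonneg p.2
    have h : 0 ≤ ∑ j, ∑ k, |p.1.2.1 j k| := by positivity
    unfold RR RW; linarith⟩

lemma lb_T (i : J) : LB d.ps RR (fun p => d.T p.1.1 p.1.2 p.2 i) := by
  obtain ⟨B, hB⟩ := d.bd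
  unfold T
  refine LB.add ?_ (LB.sum _ RR_nonneg fun k =>
    LB.bmul (c := fun _ => d.v k i) (B := |d.v k i|) (fun _ _ => le_rfl) (LB.add
      (LB.bmul (B := B) (fun p hp => (hB _ hp.1.1 k).1) (lb_xiU k _))
      (LB.bmul (B := B) (fun p hp => (hB _ hp.1.1 k).2.2.1) (lb_xiW k _))))
  obtain ⟨C, hC, h⟩ := d.gb i
  refine ⟨C, hC, fun p _ => (h _).trans (mul_le_mul_of_nonneg_left ?_ hC)⟩
  have := RU_nonneg p.2
  have := RU_nonneg p.1.2.2
  unfold RR RW; linarith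

lemma lb_eta (k : Kx m n) : LB d.ps RR (fun p => d.eta p.1.1 p.1.2 p.2 k) := by
  obtain ⟨B, hB⟩ := d.bd
  unfold eta
  exact (LB.add
      (LB.bmul (B := B) (fun p hp => (hB _ hp.1.1 k).2.1) (lb_xiU k _))
      (LB.bmul (B := B) (fun p hp => (hB _ hp.1.1 k).2.2.2) (lb_xiW k _)))

lemma lb_dT (i : J) : LB d.ps RR (fun p => d.dT p.1.1 p.1.2 p.2 i) :=
  LB.sum _ RR_nonneg fun k =>
    LB.bmul (c := fun _ => d.v k i) (B := |d.v k i|) (fun _ _ => le_rfl) (d.lb_eta k)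

lemma lb_slice {f : (ℝ × Om m n) × Us m n → ℝ} (hf : LB d.ps RR f) (ω : Om m n) :
    LB (Metric.ball d.ρ0 d.ε ×ˢ Set.univ) (fun p : ℝ × Us m n => RU p.2)
      (fun p => f ((p.1, ω), p.2)) := by
  obtain ⟨C, hC, h⟩ := hf
  have h1 := RW_nonneg ω
  refine ⟨C * (1 + RW ω), by positivity, fun p hp => (h ((p.1, ω), p.2) ⟨⟨hp.1, trivial⟩, trivial⟩).trans ?_⟩
  have := RU_nonneg p.2
  unfold RR
  rw [mul_assoc]
  exact mul_le_mul_of_nonneg_left (by simp only; nlinarith) hC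

lemma mem0 : d.ρ0 ∈ Metric.ball d.ρ0 d.ε := Metric.mem_ball_self d.hε

lemma lb_sliceU {f : (ℝ × Om m n) × Us m n → ℝ} (hf : LB d.ps RR f) (ω : Om m n) :
    LB Set.univ RU (fun U => f ((d.ρ0, ω), U)) := by
  obtain ⟨C, hC, h⟩ := d.lb_slice hf ω
  exact ⟨C, hC, fun U _ => h (d.ρ0, U) ⟨d.mem0, trivial⟩⟩

lemma cont_T (ρ : ℝ) : Continuous (fun p : Om m n × Us m n => d.T ρ p.1 p.2) := by
  have := d.gc
  have h := continuous_xi (m := m) (n := n)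
  unfold T
  fun_prop

lemma cont_eta (ρ : ℝ) (k : Kx m n) : Continuous (fun p : Om m n × Us m n => d.eta ρ p.1 p.2 k) := by
  have h := continuous_xi (m := m) (n := n)
  unfold eta
  fun_prop

lemma cont_dT (ρ : ℝ) : Continuous (fun p : Om m n × Us m n => d.dT ρ p.1 p.2) := by
  have h := d.cont_eta
  unfold dT
  fun_prop

lemma deriv_T (ρ : ℝ) (hρ : ρ ∈ Metric.ball d.ρ0 d.ε) (ω : Om m n) (U : Us m n) (i : J) :
    HasDerivAt (fun ρ => d.T ρ ω U i) (d.dT ρ ω U i) ρ := by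
  unfold T dT eta
  refine HasDerivAt.const_add _ (HasDerivAt.fun_sum fun k _ => HasDerivAt.const_mul _ ?_)
  exact ((d.ha ρ hρ k).mul_const _).add ((d.hb ρ hρ k).mul_const _)

lemma T_addU (ρ : ℝ) (ω : Om m n) (U : Us m n) (k : Kx m n) (r : ℝ) (i : J) :
    d.T ρ ω (U + r • eb k) i = d.T ρ ω U i + r * (d.v k i * d.a k ρ) := by
  unfold T
  simp only [xi_add]
  rw [add_assoc]
  congr 1
  have : ∀ k', d.v k' i * (d.a k' ρ * (xi k' U + r * if k' = k then 1 else 0) + d.b k' ρ * xi k' ω.2)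
     = d.v k' i * (d.a k' ρ * xi k' U + d.b k' ρ * xi k' ω.2) +
       (if k' = k then r * (d.v k' i * d.a k' ρ) else 0) := by
    intro k'; split_ifs <;> ring
  simp only [this, Finset.sum_add_distrib, Finset.sum_ite_eq', Finset.mem_univ, if_true]

lemma T_addW (ρ : ℝ) (ω : Om m n) (U : Us m n) (k : Kx m n) (r : ℝ) (i : J) :
    d.T ρ (ω + r • ((0 : Fin m → Fin n → ℝ), eb k)) U i = d.T ρ ω U i + r * (d.v k i * d.b k ρ) := by
  unfold T
  simp only [Prod.fst_add, Prod.snd_add, Prod.smul_fst, Prod.smul_snd, smul_zero, add_zero, xi_add]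
  rw [add_assoc]
  congr 1
  have : ∀ k', d.v k' i * (d.a k' ρ * xi k' U + d.b k' ρ * (xi k' ω.2 + r * if k' = k then 1 else 0))
     = d.v k' i * (d.a k' ρ * xi k' U + d.b k' ρ * xi k' ω.2) +
       (if k' = k then r * (d.v k' i * d.b k' ρ) else 0) := by
    intro k'; split_ifs <;> ring
  simp only [this, Finset.sum_add_distrib, Finset.sum_ite_eq', Finset.mem_univ, if_true]

/-- directional derivative -/
def Fv (k : Kx m n) (D : J → ℝ) : ℝ := ∑ i, d.v k i * d.F1 i D

/-- partial of directional derivative -/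
def Fv1 (k : Kx m n) (j : J) (D : J → ℝ) : ℝ := ∑ i, d.v k i * d.F2 i j D

/-- second directional derivative -/
def Fvv (k : Kx m n) (D : J → ℝ) : ℝ := ∑ j, d.v k j * d.Fv1 k j D

lemma SJ_nonneg (D : J → ℝ) : 0 ≤ SJ D := by unfold SJ; positivity

lemma hFv (k : Kx m n) : CD (d.Fv k) (d.Fv1 k) where
  cont := by
    have := fun i => (d.hF1 i).cont
    unfold Fv; fun_prop
  cont1 := fun j => by
    have := fun i => (d.hF1 i).cont1 j
    unfold Fv1; fun_prop
  chain := fun D D' r h => by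
    unfold Fv Fv1
    have := HasDerivAt.fun_sum (u := Finset.univ) fun i _ =>
      ((d.hF1 i).chain D D' r h).const_mul (d.v k i)
    refine this.congr_deriv ?_
    simp only [Finset.mul_sum, Finset.sum_mul]
    rw [Finset.sum_comm]
    simp only [mul_assoc]

lemma eFv (k : Kx m n) : EBd Set.univ SJ (d.Fv k) :=
  EBd.sum _ SJ_nonneg fun i => (EBd.const SJ_nonneg _).mul (d.eF1 i)

lemma eFv1 (k : Kx m n) (j : J) : EBd Set.univ SJ (d.Fv1 k j) :=
  EBd.sum _ SJ_nonneg fun i => (EBd.const SJ_nonneg _).mul (d.eF2 i j)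

lemma eFvv (k : Kx m n) : EBd Set.univ SJ (d.Fvv k) :=
  EBd.sum _ SJ_nonneg fun i => (EBd.const SJ_nonneg _).mul (d.eFv1 k i)

lemma cFvv (k : Kx m n) : Continuous (d.Fvv k) := by
  have := (d.hFv k).cont1
  unfold Fvv; fun_prop

/-- inner integral of a function of the field -/
def I (H : (J → ℝ) → ℝ) (ρ : ℝ) (ω : Om m n) : ℝ := ∫ U, H (d.T ρ ω U) ∂ muU m n

lemma int_U {H : (J → ℝ) → ℝ} (cH : Continuous H) (eH : EBd Set.univ SJ H) (ρ : ℝ)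
    (hρ : ρ ∈ Metric.ball d.ρ0 d.ε) (ω : Om m n) :
    Integrable (fun U => H (d.T ρ ω U)) (muU m n) := by
  refine EBd.integrable_U (EBd.comp RU_nonneg eH fun i => ?_) ?_
  · obtain ⟨C, hC, h⟩ := d.lb_slice (d.lb_T i) ω
    exact ⟨C, hC, fun U _ => h (ρ, U) ⟨hρ, trivial⟩⟩
  · exact (cH.comp ((d.cont_T ρ).comp (by fun_prop : Continuous fun U => (ω, U)))).aestronglyMeasurable

lemma RWs_nonneg (p : ℝ × Om m n) : 0 ≤ RW p.2 := RW_nonneg _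

lemma e_I {H : (J → ℝ) → ℝ} (eH : EBd Set.univ SJ H) :
    EBd (Metric.ball d.ρ0 d.ε ×ˢ Set.univ) (fun p : ℝ × Om m n => RW p.2) (fun p => d.I H p.1 p.2) :=
  EBd.integral RWs_nonneg (f := fun p U => H (d.T p.1 p.2 U)) (EBd.comp RR_nonneg eH d.lb_T)

lemma e_Iinv :
    EBd (Metric.ball d.ρ0 d.ε ×ˢ Set.univ) (fun p : ℝ × Om m n => RW p.2)
      (fun p => (d.I d.F p.1 p.2)⁻¹) :=
  EBd.inv_integral RWs_nonneg (f := fun p U => d.F (d.T p.1 p.2 U)) (fun _ _ => d.pos _)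
    (fun p hp => d.int_U d.hF.cont d.eF p.1 hp.1 p.2)
    (EBd.comp (H := fun D => (d.F D)⁻¹) RR_nonneg d.eFi d.lb_T)

lemma I_pos (ρ : ℝ) (hρ : ρ ∈ Metric.ball d.ρ0 d.ε) (ω : Om m n) : 0 < d.I d.F ρ ω := by
  unfold I
  rw [integral_pos_iff_support_of_nonneg (fun U => (d.pos _).le) (d.int_U d.hF.cont d.eF ρ hρ ω)]
  have : (Function.support fun U => d.F (d.T ρ ω U)) = Set.univ := by
    ext U; simp [(d.pos _).ne']
  rw [this]; simp

lemma meas_I {H : (J → ℝ) → ℝ} (cH : Continuous H) (ρ : ℝ) : StronglyMeasurable (d.I H ρ) :=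
  StronglyMeasurable.integral_prod_right (f := fun ω U => H (d.T ρ ω U))
    (cH.comp (d.cont_T ρ)).stronglyMeasurable

/-- derivative of the inner integral -/
def dI (ρ : ℝ) (ω : Om m n) : ℝ := ∫ U, ∑ i, d.F1 i (d.T ρ ω U) * d.dT ρ ω U i ∂ muU m n

lemma meas_dI (ρ : ℝ) : StronglyMeasurable (d.dI ρ) := by
  refine StronglyMeasurable.integral_prod_right
    (f := fun ω U => ∑ i, d.F1 i (d.T ρ ω U) * d.dT ρ ω U i) (Continuous.stronglyMeasurable ?_)
  exact continuous_finsetSum _ fun i _ => ((d.hF.cont1 i).comp (d.cont_T ρ)).mul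
    ((continuous_apply i).comp (d.cont_dT ρ))

lemma e_dI :
    EBd (Metric.ball d.ρ0 d.ε ×ˢ Set.univ) (fun p : ℝ × Om m n => RW p.2) (fun p => d.dI p.1 p.2) :=
  EBd.integral RWs_nonneg (f := fun p U => ∑ i, d.F1 i (d.T p.1 p.2 U) * d.dT p.1 p.2 U i)
    (EBd.sum _ RR_nonneg fun i => (EBd.comp RR_nonneg (d.eF1 i) d.lb_T).mul (d.lb_dT i).toE)

lemma deriv_I (ρ : ℝ) (hρ : ρ ∈ Metric.ball d.ρ0 d.ε) (ω : Om m n) :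
    HasDerivAt (fun ρ => d.I d.F ρ ω) (d.dI ρ ω) ρ := by
  obtain ⟨δ, hδ, hsub⟩ := Metric.isOpen_iff.1 Metric.isOpen_ball ρ hρ
  have cs : Continuous fun U : Us m n => (ω, U) := by fun_prop
  refine curve_deriv d.hF d.eF d.eF1 (fun ρ U => d.T ρ ω U) (fun ρ U => d.dT ρ ω U) ρ δ hδ
    (fun r hr U i => d.deriv_T r (hsub hr) ω U i) (fun i => ?_) (fun i => ?_)
    (fun r => (d.cont_T r).comp cs) (fun r => (d.cont_dT r).comp cs)
  · obtain ⟨C, hC, h⟩ := d.lb_slice (d.lb_T i) ω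
    exact ⟨C, hC, fun p hp => h p ⟨hsub hp.1, trivial⟩⟩
  · obtain ⟨C, hC, h⟩ := d.lb_slice (d.lb_dT i) ω
    exact ⟨C, hC, fun p hp => h p ⟨hsub hp.1, trivial⟩⟩

lemma slice0 {f : ℝ × Om m n → ℝ}
    (h : EBd (Metric.ball d.ρ0 d.ε ×ˢ Set.univ) (fun p : ℝ × Om m n => RW p.2) f) :
    EBd Set.univ RW (fun ω => f (d.ρ0, ω)) := by
  obtain ⟨C, hC, h⟩ := h
  exact ⟨C, hC, fun U _ => h (d.ρ0, U) ⟨d.mem0, trivial⟩⟩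

lemma abs_log_le {x : ℝ} (hx : 0 < x) : |log x| ≤ |x + x⁻¹| := by
  have h1 := log_le_sub_one_of_pos hx
  have h2 := log_le_sub_one_of_pos (inv_pos.2 hx)
  rw [log_inv] at h2
  have := inv_pos.2 hx
  rw [abs_of_pos (by positivity : 0 < x + x⁻¹), abs_le]
  constructor <;> linarith

lemma deriv_psi :
    HasDerivAt (fun ρ => ∫ ω, log (d.I d.F ρ ω) ∂ muGU m n)
      (∫ ω, d.dI d.ρ0 ω / d.I d.F d.ρ0 ω ∂ muGU m n) d.ρ0 := by
  have e1 : EBd (Metric.ball d.ρ0 d.ε ×ˢ Set.univ) (fun p : ℝ × Om m n => RW p.2)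
      (fun p => d.dI p.1 p.2 / d.I d.F p.1 p.2) := by
    simp only [div_eq_mul_inv]; exact d.e_dI.mul d.e_Iinv
  obtain ⟨C, hC, hb⟩ := e1
  refine (hasDerivAt_integral_of_dominated_loc_of_deriv_le (s := Metric.ball d.ρ0 d.ε)
    (bound := fun U => exp (C * (1 + RW U)))
    (F' := fun ρ ω => d.dI ρ ω / d.I d.F ρ ω) (Metric.ball_mem_nhds _ d.hε)
    (.of_forall fun r => (d.meas_I d.hF.cont r).measurable.log.aestronglyMeasurable) ?_
    ((d.meas_dI d.ρ0).div (d.meas_I d.hF.cont d.ρ0)).aestronglyMeasurable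
    (.of_forall fun U r hr => hb (r, U) ⟨hr, trivial⟩) ?_
    (.of_forall fun ω r hr => (d.deriv_I r hr ω).log (d.I_pos r hr ω).ne')).2
  · refine EBd.integrable_W ?_ (d.meas_I d.hF.cont d.ρ0).measurable.log.aestronglyMeasurable
    refine EBd.mono_abs (EBd.add RW_nonneg (d.slice0 (d.e_I d.eF)) (d.slice0 d.e_Iinv)) (fun ω _ => ?_)
    exact abs_log_le (d.I_pos _ d.mem0 ω)
  · have := (integrable_exp_RW (m := m) (n := n) C).const_mul (exp C)
    refine this.congr (.of_forall fun U => ?_)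
    simp only
    rw [← exp_add]; congr 1; ring

end Dat


namespace Dat
variable {J : Type} [Fintype J] (d : Dat m n J)

lemma ibp_inner (k : Kx m n) (ω : Om m n) :
    ∫ U, xi k U * d.Fv k (d.T d.ρ0 ω U) ∂ muU m n = d.a k d.ρ0 * d.I (d.Fvv k) d.ρ0 ω := by
  have cs : Continuous fun U : Us m n => d.T d.ρ0 ω U :=
    (d.cont_T d.ρ0).comp (by fun_prop : Continuous fun U => (ω, U))
  rw [I, ← integral_const_mul]
  refine ibp_muU k (fun U => d.Fv k (d.T d.ρ0 ω U)) _ (fun U => ?_)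
    (d.int_U (d.hFv k).cont (d.eFv k) _ d.mem0 ω)
    ((d.int_U (d.cFvv k) (d.eFvv k) _ d.mem0 ω).const_mul _) ?_
  · have := (d.hFv k).chain (fun r => d.T d.ρ0 ω (U + r • eb k)) (fun i => d.v k i * d.a k d.ρ0) 0
      (fun i => by
        simp only [T_addU]
        simpa using ((hasDerivAt_id (0:ℝ)).mul_const (d.v k i * d.a k d.ρ0)).const_add (d.T d.ρ0 ω U i))
    refine this.congr_deriv ?_
    simp only [zero_smul, add_zero, Fvv, Finset.mul_sum]
    exact Finset.sum_congr rfl fun i _ => by ring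
  · refine EBd.integrable_U (EBd.mul ?_ (EBd.comp RU_nonneg (d.eFv k) fun i => d.lb_sliceU (d.lb_T i) ω))
      ((continuous_xi k).mul ((d.hFv k).cont.comp cs)).aestronglyMeasurable
    exact (d.lb_sliceU (lb_xiU k _) ω).toE

lemma dI_eq (ω : Om m n) :
    d.dI d.ρ0 ω = ∑ k, (d.a k d.ρ0 * d.a' k d.ρ0 * d.I (d.Fvv k) d.ρ0 ω
      + d.b' k d.ρ0 * (xi k ω.2 * d.I (d.Fv k) d.ρ0 ω)) := by
  have cs : Continuous fun U : Us m n => d.T d.ρ0 ω U :=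
    (d.cont_T d.ρ0).comp (by fun_prop : Continuous fun U => (ω, U))
  have h1 : ∀ U, ∑ i, d.F1 i (d.T d.ρ0 ω U) * d.dT d.ρ0 ω U i =
      ∑ k, (d.a' k d.ρ0 * (xi k U * d.Fv k (d.T d.ρ0 ω U))
        + d.b' k d.ρ0 * xi k ω.2 * d.Fv k (d.T d.ρ0 ω U)) := by
    intro U
    simp only [dT, eta, Fv, Finset.mul_sum, ← Finset.sum_add_distrib]
    rw [Finset.sum_comm]
    exact Finset.sum_congr rfl fun k _ => Finset.sum_congr rfl fun i _ => by ring
  have i1 : ∀ k, Integrable (fun U => xi k U * d.Fv k (d.T d.ρ0 ω U)) (muU m n) := fun k =>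
    EBd.integrable_U (EBd.mul (d.lb_sliceU (lb_xiU k _) ω).toE
      (EBd.comp RU_nonneg (d.eFv k) fun i => d.lb_sliceU (d.lb_T i) ω))
      ((continuous_xi k).mul ((d.hFv k).cont.comp cs)).aestronglyMeasurable
  have i2 : ∀ k, Integrable (fun U => d.Fv k (d.T d.ρ0 ω U)) (muU m n) := fun k =>
    d.int_U (d.hFv k).cont (d.eFv k) _ d.mem0 ω
  unfold dI
  simp only [h1]
  rw [integral_finsetSum]
  swap
  · intro k _
    exact ((i1 k).const_mul _).add ((i2 k).const_mul _)
  refine Finset.sum_congr rfl fun k _ => ?_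
  rw [integral_add ((i1 k).const_mul _) ((i2 k).const_mul _), integral_const_mul, integral_const_mul,
    ibp_inner]
  unfold I
  ring

lemma deriv_IW {H : (J → ℝ) → ℝ} {H1 : J → (J → ℝ) → ℝ} (h : CD H H1)
    (eH : EBd Set.univ SJ H) (eH1 : ∀ i, EBd Set.univ SJ (H1 i)) (k : Kx m n) (ω : Om m n) :
    HasDerivAt (fun r : ℝ => d.I H d.ρ0 (ω + r • ((0 : Fin m → Fin n → ℝ), eb k)))
      (d.b k d.ρ0 * d.I (fun D => ∑ i, d.v k i * H1 i D) d.ρ0 ω) 0 := by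
  have cs : Continuous fun U : Us m n => (ω, U) := by fun_prop
  have hc := (d.cont_T d.ρ0).comp cs
  have hR : ∀ p : ℝ × Us m n, 0 ≤ RU p.2 := fun p => RU_nonneg _
  have := curve_deriv h eH eH1 (fun r U i => d.T d.ρ0 ω U i + r * (d.v k i * d.b k d.ρ0))
    (fun r U i => d.v k i * d.b k d.ρ0) 0 1 one_pos
    (fun r _ U i => by
      simpa using ((hasDerivAt_id r).mul_const (d.v k i * d.b k d.ρ0)).const_add (d.T d.ρ0 ω U i))
    (fun i => LB.add ?_ ?_) (fun i => LB.const hR _) (fun r => ?_) (fun r => continuous_const)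
  · have e : (fun r : ℝ => d.I H d.ρ0 (ω + r • ((0 : Fin m → Fin n → ℝ), eb k))) =
        fun r => ∫ U, H (fun i => d.T d.ρ0 ω U i + r * (d.v k i * d.b k d.ρ0)) ∂ muU m n := by
      ext r
      unfold I
      congr 1; ext U; congr 1; ext i
      rw [T_addW]
    rw [e]
    refine this.congr_deriv ?_
    unfold I
    rw [← integral_const_mul]
    congr 1; ext U
    simp only [zero_mul, add_zero, Finset.mul_sum]
    exact Finset.sum_congr rfl fun i _ => by ring
  · obtain ⟨C, hC, h⟩ := d.lb_sliceU (d.lb_T i) ω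
    exact ⟨C, hC, fun p _ => h p.2 trivial⟩
  · refine LB.bmul (B := 1) (c := fun p => p.1) (fun p hp => ?_) (LB.const hR _)
    have := hp.1
    simp only [Metric.mem_ball, dist_zero_right, norm_eq_abs] at this
    exact this.le
  · refine continuous_pi fun i => ((continuous_apply i).comp hc).add continuous_const

/-- normalized first directional derivative -/
def q (k : Kx m n) (ω : Om m n) : ℝ := d.I (d.Fv k) d.ρ0 ω / d.I d.F d.ρ0 ω
/-- normalized second directional derivative -/
def h (k : Kx m n) (ω : Om m n) : ℝ := d.I (d.Fvv k) d.ρ0 ω / d.I d.F d.ρ0 ω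

lemma e_q (k : Kx m n) : EBd Set.univ RW (d.q k) := by
  unfold q; simp only [div_eq_mul_inv]
  exact (d.slice0 (d.e_I (d.eFv k))).mul (d.slice0 d.e_Iinv)

lemma e_h (k : Kx m n) : EBd Set.univ RW (d.h k) := by
  unfold h; simp only [div_eq_mul_inv]
  exact (d.slice0 (d.e_I (d.eFvv k))).mul (d.slice0 d.e_Iinv)

lemma m_q (k : Kx m n) : StronglyMeasurable (d.q k) :=
  (d.meas_I (d.hFv k).cont d.ρ0).div (d.meas_I d.hF.cont d.ρ0)

lemma m_h (k : Kx m n) : StronglyMeasurable (d.h k) :=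
  (d.meas_I (d.cFvv k) d.ρ0).div (d.meas_I d.hF.cont d.ρ0)

lemma int_h (k : Kx m n) : Integrable (d.h k) (muGU m n) :=
  (d.e_h k).integrable_W (d.m_h k).aestronglyMeasurable

lemma int_q (k : Kx m n) : Integrable (d.q k) (muGU m n) :=
  (d.e_q k).integrable_W (d.m_q k).aestronglyMeasurable

lemma int_q2 (k : Kx m n) : Integrable (fun ω => d.q k ω ^ 2) (muGU m n) := by
  simp only [pow_two]
  exact ((d.e_q k).mul (d.e_q k)).integrable_W ((d.m_q k).mul (d.m_q k)).aestronglyMeasurable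

lemma int_xq (k : Kx m n) : Integrable (fun ω => xi k ω.2 * d.q k ω) (muGU m n) := by
  refine EBd.integrable_W (EBd.mul ?_ (d.e_q k))
    (((continuous_xi k).comp continuous_snd).stronglyMeasurable.mul (d.m_q k)).aestronglyMeasurable
  refine LB.toE ⟨1, zero_le_one, fun ω _ => ?_⟩
  have := abs_xi_le k ω.2
  have h : 0 ≤ ∑ j, ∑ k, |ω.1 j k| := by positivity
  unfold RW; linarith

lemma ibp_outer (k : Kx m n) :
    ∫ ω, xi k ω.2 * d.q k ω ∂ muGU m n =
      d.b k d.ρ0 * (∫ ω, d.h k ω ∂ muGU m n - ∫ ω, d.q k ω ^ 2 ∂ muGU m n) := by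
  rw [← integral_sub (d.int_h k) (d.int_q2 k), ← integral_const_mul]
  refine ibp_muGU k (d.q k) _ (fun ω => ?_) (d.int_q k)
    (((d.int_h k).sub (d.int_q2 k)).const_mul _) (d.int_xq k)
  have hN := (d.I_pos d.ρ0 d.mem0 ω).ne'
  have h1 := d.deriv_IW (d.hFv k) (d.eFv k) (d.eFv1 k) k ω
  have h2 := d.deriv_IW d.hF d.eF d.eF1 k ω
  have h3 := h1.div h2 (by simpa using hN)
  refine h3.congr_deriv ?_
  simp only [zero_smul, add_zero]
  change (d.b k d.ρ0 * d.I (d.Fvv k) d.ρ0 ω * d.I d.F d.ρ0 ω -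
    d.I (d.Fv k) d.ρ0 ω * (d.b k d.ρ0 * d.I (d.Fv k) d.ρ0 ω)) / d.I d.F d.ρ0 ω ^ 2 = _
  unfold h q
  field_simp

theorem main :
    HasDerivAt (fun ρ => ∫ ω, log (d.I d.F ρ ω) ∂ muGU m n)
      (-∑ k, d.b k d.ρ0 * d.b' k d.ρ0 * ∫ ω, d.q k ω ^ 2 ∂ muGU m n) d.ρ0 := by
  refine d.deriv_psi.congr_deriv ?_
  have e : ∀ ω, d.dI d.ρ0 ω / d.I d.F d.ρ0 ω = ∑ k, (d.a k d.ρ0 * d.a' k d.ρ0 * d.h k ω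
      + d.b' k d.ρ0 * (xi k ω.2 * d.q k ω)) := by
    intro ω
    rw [dI_eq, Finset.sum_div]
    refine Finset.sum_congr rfl fun k _ => ?_
    unfold h q; ring
  simp only [e]
  rw [integral_finsetSum]
  swap
  · intro k _
    exact ((d.int_h k).const_mul _).add ((d.int_xq k).const_mul _)
  rw [← Finset.sum_neg_distrib]
  refine Finset.sum_congr rfl fun k _ => ?_
  rw [integral_add ((d.int_h k).const_mul _) ((d.int_xq k).const_mul _), integral_const_mul,
    integral_const_mul, ibp_outer, d.hab]
  ring

end Dat


lemma SJ_nonneg {J : Type} [Fintype J] (D : J → ℝ) : 0 ≤ SJ D := by unfold SJ; positivity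

lemma EBd.rpow {α : Type} {S : Set α} {R : α → ℝ} {f : α → ℝ} (hpos : ∀ a, 0 < f a)
    (hf : EBd S R f) (hi : EBd S R (fun a => (f a)⁻¹)) (hR : ∀ a, 0 ≤ R a) (e : ℝ) :
    EBd S R (fun a => f a ^ e) := by
  obtain ⟨C, hC, h⟩ := hf
  obtain ⟨C', hC', h'⟩ := hi
  refine ⟨|e| * (C + C'), by positivity, fun a ha => ?_⟩
  have h1 := h a ha
  have h2 := h' a ha
  have p := hpos a
  rw [abs_of_pos p] at h1
  rw [abs_of_pos (inv_pos.2 p)] at h2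
  have l1 : log (f a) ≤ C * (1 + R a) := (log_le_iff_le_exp p).2 h1
  have l2 : -log (f a) ≤ C' * (1 + R a) := by
    rw [← log_inv]; exact (log_le_iff_le_exp (inv_pos.2 p)).2 h2
  have hRa := hR a
  have x1 : 0 ≤ C * (1 + R a) := by positivity
  have x2 : 0 ≤ C' * (1 + R a) := by positivity
  have l3 : |log (f a)| ≤ (C + C') * (1 + R a) := abs_le.2 ⟨by linarith, by linarith⟩
  rw [abs_of_pos (rpow_pos_of_pos p e), rpow_def_of_pos p]
  refine exp_le_exp.2 ?_
  calc log (f a) * e ≤ |log (f a) * e| := le_abs_self _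
    _ = |e| * |log (f a)| := by rw [abs_mul, mul_comm]
    _ ≤ |e| * ((C + C') * (1 + R a)) := mul_le_mul_of_nonneg_left l3 (abs_nonneg _)
    _ = _ := by ring

section conc
variable (β s m1 : ℝ)

/-- abstract exponentials -/
def cA (D : Fin l × Fin l → ℝ) (i : Fin l × Fin l) : ℝ := exp (β * D i)
/-- abstract inner sums -/
def cC (D : Fin l × Fin l → ℝ) (i1 : Fin l) : ℝ := ∑ i2, cA β D (i1, i2)
/-- abstract partition function -/
def cZ (D : Fin l × Fin l → ℝ) : ℝ := ∑ i1, cC β D i1 ^ s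
/-- power of the partition function -/
def cF (D : Fin l × Fin l → ℝ) : ℝ := cZ β s D ^ m1
/-- Gibbs weight -/
def cg (i : Fin l × Fin l) (D : Fin l × Fin l → ℝ) : ℝ :=
  cC β D i.1 ^ s / cZ β s D * (cA β D i / cC β D i.1)
/-- first derivatives -/
def cF1 (i : Fin l × Fin l) (D : Fin l × Fin l → ℝ) : ℝ := m1 * s * β * (cF β s m1 D * cg β s i D)
/-- second derivatives -/
def cF2 (i j : Fin l × Fin l) (D : Fin l × Fin l → ℝ) : ℝ :=
  m1 * s * β * (cF1 β s m1 j D * cg β s i D + cF β s m1 D * (cg β s i D *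
    ((s - 1) * β * (if j.1 = i.1 then cA β D j / cC β D i.1 else 0) + (if j = i then β else 0)
      - s * β * cg β s j D)))

variable {β s m1}

lemma cA_pos (D : Fin l × Fin l → ℝ) (i) : 0 < cA β D i := exp_pos _

lemma cC_pos (D : Fin l × Fin l → ℝ) (i1) : 0 < cC β D i1 :=
  Finset.sum_pos (fun i _ => cA_pos D _) ⟨i1, Finset.mem_univ _⟩

lemma cZ_pos (i0 : Fin l) (D : Fin l × Fin l → ℝ) : 0 < cZ β s D :=
  Finset.sum_pos (fun i _ => rpow_pos_of_pos (cC_pos D _) _) ⟨i0, Finset.mem_univ _⟩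

lemma cF_pos (i0 : Fin l) (D : Fin l × Fin l → ℝ) : 0 < cF β s m1 D :=
  rpow_pos_of_pos (cZ_pos i0 D) _

lemma cg_nonneg (i : Fin l × Fin l) (D : Fin l × Fin l → ℝ) : 0 ≤ cg β s i D := by
  have := cA_pos (β := β) D i
  have := cC_pos (β := β) D i.1
  have := cZ_pos (β := β) (s := s) i.1 D
  unfold cg; positivity

lemma cAC_le (D : Fin l × Fin l → ℝ) (i : Fin l × Fin l) : cA β D i / cC β D i.1 ≤ 1 := by
  rw [div_le_one (cC_pos D _)]
  exact Finset.single_le_sum (f := fun i2 => cA β D (i.1, i2)) (fun j _ => (cA_pos D _).le)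
    (Finset.mem_univ i.2)

lemma cg_le (i : Fin l × Fin l) (D : Fin l × Fin l → ℝ) : cg β s i D ≤ 1 := by
  have h1 := cAC_le (β := β) D i
  have h2 : cC β D i.1 ^ s / cZ β s D ≤ 1 := by
    rw [div_le_one (cZ_pos i.1 D)]
    exact Finset.single_le_sum (f := fun i1 => cC β D i1 ^ s)
      (fun j _ => (rpow_pos_of_pos (cC_pos D _) _).le) (Finset.mem_univ i.1)
  have := cA_pos (β := β) D i
  have := cC_pos (β := β) D i.1
  exact mul_le_one₀ h2 (by positivity) h1

lemma cont_cA (i) : Continuous fun D : Fin l × Fin l → ℝ => cA β D i := by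
  unfold cA; fun_prop

lemma cont_cC (i) : Continuous fun D : Fin l × Fin l → ℝ => cC β D i :=
  continuous_finsetSum _ fun j _ => cont_cA _

lemma cont_cZ : Continuous fun D : Fin l × Fin l → ℝ => cZ β s D :=
  continuous_finsetSum _ fun j _ => (cont_cC _).rpow_const fun D => Or.inl (cC_pos D j).ne'

lemma cont_cF (i0 : Fin l) : Continuous fun D : Fin l × Fin l → ℝ => cF β s m1 D :=
  cont_cZ.rpow_const fun D => Or.inl (cZ_pos i0 D).ne'

lemma cont_cg (i : Fin l × Fin l) : Continuous (cg β s i) :=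
  (((cont_cC _).rpow_const fun D => Or.inl (cC_pos D _).ne').div cont_cZ
    fun D => (cZ_pos i.1 D).ne').mul ((cont_cA _).div (cont_cC _) fun D => (cC_pos D _).ne')

lemma cont_cF1 (i : Fin l × Fin l) : Continuous (cF1 β s m1 i) :=
  continuous_const.mul ((cont_cF i.1).mul (cont_cg i))

lemma cont_cF2 (i j : Fin l × Fin l) : Continuous (cF2 β s m1 i j) := by
  unfold cF2
  refine continuous_const.mul (((cont_cF1 j).mul (cont_cg i)).add ((cont_cF i.1).mul
    ((cont_cg i).mul (((continuous_const.mul ?_).add ?_).sub (continuous_const.mul (cont_cg j))))))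
  · split_ifs
    · exact (cont_cA _).div (cont_cC _) fun D => (cC_pos D _).ne'
    · exact continuous_const
  · exact continuous_const

section chain
variable {D : ℝ → Fin l × Fin l → ℝ} {D' : Fin l × Fin l → ℝ} {r : ℝ}

/-- logarithmic derivative of the inner sum -/
def LCd (β : ℝ) (D D' : Fin l × Fin l → ℝ) (i1 : Fin l) : ℝ :=
  ∑ j2, cA β D (i1, j2) / cC β D i1 * D' (i1, j2)

lemma hd_cA (h : ∀ i, HasDerivAt (fun r => D r i) (D' i) r) (i) :
    HasDerivAt (fun r => cA β (D r) i) (cA β (D r) i * (β * D' i)) r :=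
  ((h i).const_mul β).exp

lemma hd_cC (h : ∀ i, HasDerivAt (fun r => D r i) (D' i) r) (i) :
    HasDerivAt (fun r => cC β (D r) i) (β * cC β (D r) i * LCd β (D r) D' i) r := by
  refine (HasDerivAt.fun_sum fun j _ => hd_cA h (i, j)).congr_deriv ?_
  have := (cC_pos (β := β) (D r) i).ne'
  unfold LCd
  rw [Finset.mul_sum]
  refine Finset.sum_congr rfl fun j _ => ?_
  field_simp

lemma hd_cCs (h : ∀ i, HasDerivAt (fun r => D r i) (D' i) r) (i) :
    HasDerivAt (fun r => cC β (D r) i ^ s) (s * β * cC β (D r) i ^ s * LCd β (D r) D' i) r := by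
  have p := cC_pos (β := β) (D r) i
  refine ((hd_cC h i).rpow_const (p := s) (Or.inl p.ne')).congr_deriv ?_
  rw [rpow_sub_one p.ne']
  field_simp

lemma hd_cZ (i0 : Fin l) (h : ∀ i, HasDerivAt (fun r => D r i) (D' i) r) :
    HasDerivAt (fun r => cZ β s (D r)) (s * β * cZ β s (D r) * ∑ j, cg β s j (D r) * D' j) r := by
  refine (HasDerivAt.fun_sum fun j _ => hd_cCs h j).congr_deriv ?_
  have p := (cZ_pos (β := β) (s := s) i0 (D r)).ne'
  rw [Fintype.sum_prod_type, Finset.mul_sum]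
  refine Finset.sum_congr rfl fun i1 _ => ?_
  unfold LCd
  rw [Finset.mul_sum, Finset.mul_sum]
  refine Finset.sum_congr rfl fun j _ => ?_
  unfold cg
  field_simp

lemma hd_cF (i0 : Fin l) (h : ∀ i, HasDerivAt (fun r => D r i) (D' i) r) :
    HasDerivAt (fun r => cF β s m1 (D r)) (∑ j, cF1 β s m1 j (D r) * D' j) r := by
  have p := cZ_pos (β := β) (s := s) i0 (D r)
  refine ((hd_cZ (s := s) (β := β) i0 h).rpow_const (p := m1) (Or.inl p.ne')).congr_deriv ?_
  rw [rpow_sub_one p.ne', Finset.mul_sum, Finset.sum_mul, Finset.sum_mul]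
  refine Finset.sum_congr rfl fun j _ => ?_
  unfold cF1 cF
  field_simp

lemma hd_cg (i : Fin l × Fin l) (h : ∀ i, HasDerivAt (fun r => D r i) (D' i) r) :
    HasDerivAt (fun r => cg β s i (D r)) (cg β s i (D r) * ((s - 1) * β * LCd β (D r) D' i.1
      + β * D' i - s * β * ∑ j, cg β s j (D r) * D' j)) r := by
  have p := (cZ_pos (β := β) (s := s) i.1 (D r)).ne'
  have p2 := (cC_pos (β := β) (D r) i.1).ne'
  refine (((hd_cCs h i.1).div (hd_cZ (s := s) i.1 h) p).mul
    ((hd_cA h i).div (hd_cC h i.1) p2)).congr_deriv ?_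
  generalize (∑ j, cg β s j (D r) * D' j) = LZ
  unfold cg
  simp only [Pi.div_apply]
  field_simp
  ring

lemma hd_cF1 (i : Fin l × Fin l) (h : ∀ i, HasDerivAt (fun r => D r i) (D' i) r) :
    HasDerivAt (fun r => cF1 β s m1 i (D r)) (∑ j, cF2 β s m1 i j (D r) * D' j) r := by
  refine (((hd_cF i.1 h).mul (hd_cg i h)).const_mul (m1 * s * β)).congr_deriv ?_
  have e1 : LCd β (D r) D' i.1 =
      ∑ j : Fin l × Fin l, (if j.1 = i.1 then cA β (D r) j / cC β (D r) i.1 else 0) * D' j := by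
    rw [Fintype.sum_prod_type, Finset.sum_eq_single i.1]
    · simp [LCd]
    · intro b _ hb
      simp [hb]
    · simp
  have e2 : β * D' i = ∑ j, (if j = i then β else 0) * D' j := by simp
  rw [e1, e2]
  unfold cF2
  simp only [Finset.mul_sum, Finset.sum_mul, ← Finset.sum_add_distrib, ← Finset.sum_sub_distrib]
  refine Finset.sum_congr rfl fun j _ => ?_
  ring

end chain

lemma CD_cF (i0 : Fin l) : CD (cF (l := l) β s m1) (cF1 β s m1) :=
  ⟨cont_cF i0, fun i => cont_cF1 i, fun D D' r h => hd_cF i0 h⟩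

lemma CD_cF1 (i : Fin l × Fin l) : CD (cF1 (l := l) β s m1 i) (cF2 β s m1 i) :=
  ⟨cont_cF1 i, fun j => cont_cF2 i j, fun D D' r h => hd_cF1 i h⟩

lemma abs_le_SJ {J : Type} [Fintype J] (D : J → ℝ) (i : J) : |D i| ≤ SJ D :=
  Finset.single_le_sum (f := fun j => |D j|) (fun j _ => abs_nonneg _) (Finset.mem_univ i)

lemma e_cA (i) : EBd Set.univ SJ fun D : Fin l × Fin l → ℝ => cA β D i := by
  refine ⟨|β|, abs_nonneg _, fun D _ => ?_⟩
  rw [abs_of_pos (cA_pos D i)]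
  refine exp_le_exp.2 ((le_abs_self _).trans ?_)
  rw [abs_mul]
  exact mul_le_mul_of_nonneg_left (by linarith [abs_le_SJ D i]) (abs_nonneg _)

lemma e_cAi (i) : EBd Set.univ SJ fun D : Fin l × Fin l → ℝ => (cA β D i)⁻¹ := by
  have := e_cA (β := -β) i
  simpa [cA, exp_neg] using this

lemma e_cC (i) : EBd Set.univ SJ fun D : Fin l × Fin l → ℝ => cC β D i :=
  EBd.sum _ SJ_nonneg fun j => e_cA _

lemma e_cCi (i) : EBd Set.univ SJ fun D : Fin l × Fin l → ℝ => (cC β D i)⁻¹ := by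
  refine (e_cAi (β := β) (i, i)).mono_abs fun D _ => ?_
  rw [abs_of_pos (inv_pos.2 (cC_pos D i)), abs_of_pos (inv_pos.2 (cA_pos D _))]
  exact inv_anti₀ (cA_pos D _) (Finset.single_le_sum (f := fun i2 => cA β D (i, i2))
    (fun j _ => (cA_pos D _).le) (Finset.mem_univ i))

lemma e_cCs (i) (e : ℝ) : EBd Set.univ SJ fun D : Fin l × Fin l → ℝ => cC β D i ^ e :=
  EBd.rpow (fun D => cC_pos D i) (e_cC i) (e_cCi i) SJ_nonneg e

lemma e_cZ : EBd Set.univ SJ fun D : Fin l × Fin l → ℝ => cZ β s D :=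
  EBd.sum _ SJ_nonneg fun j => e_cCs j s

lemma e_cZi (i0 : Fin l) : EBd Set.univ SJ fun D : Fin l × Fin l → ℝ => (cZ β s D)⁻¹ := by
  refine (e_cCs (β := β) i0 (-s)).mono_abs fun D _ => ?_
  rw [rpow_neg (cC_pos D i0).le, abs_of_pos (inv_pos.2 (cZ_pos i0 D)),
    abs_of_pos (inv_pos.2 (rpow_pos_of_pos (cC_pos D i0) s))]
  exact inv_anti₀ (rpow_pos_of_pos (cC_pos D i0) s) (Finset.single_le_sum (f := fun i => cC β D i ^ s)
    (fun j _ => (rpow_pos_of_pos (cC_pos D j) s).le) (Finset.mem_univ i0))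

lemma e_cF (i0 : Fin l) (e : ℝ) : EBd Set.univ SJ fun D : Fin l × Fin l → ℝ => cF β s e D :=
  EBd.rpow (fun D => cZ_pos i0 D) e_cZ (e_cZi i0) SJ_nonneg e

lemma e_cFi (i0 : Fin l) : EBd Set.univ SJ fun D : Fin l × Fin l → ℝ => (cF β s m1 D)⁻¹ := by
  have := e_cF (β := β) (s := s) i0 (-m1)
  refine this.mono_abs fun D _ => le_of_eq ?_
  unfold cF
  rw [rpow_neg (cZ_pos i0 D).le]

lemma e_cg (i : Fin l × Fin l) : EBd Set.univ SJ (cg β s i) := by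
  refine (EBd.const SJ_nonneg 1).mono_abs fun D _ => ?_
  rw [abs_of_nonneg (cg_nonneg i D), abs_one]
  exact cg_le i D

lemma e_cF1 (i : Fin l × Fin l) : EBd Set.univ SJ (cF1 β s m1 i) :=
  (EBd.const SJ_nonneg _).mul ((e_cF i.1 m1).mul (e_cg i))

lemma e_cF2 (i j : Fin l × Fin l) : EBd Set.univ SJ (cF2 β s m1 i j) := by
  unfold cF2
  simp only [sub_eq_add_neg _ (s * β * _), ← neg_mul (s * β)]
  refine (EBd.const SJ_nonneg _).mul (((e_cF1 j).mul (e_cg i)).add SJ_nonneg ((e_cF i.1 m1).mul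
    ((e_cg i).mul ((((EBd.const SJ_nonneg _).mul ?_).add SJ_nonneg
      (EBd.const SJ_nonneg _)).add SJ_nonneg ((EBd.const SJ_nonneg _).mul (e_cg j))))))
  split_ifs
  · simp only [div_eq_mul_inv]
    exact (e_cA j).mul (e_cCi _)
  · exact EBd.const SJ_nonneg _

end conc


lemma hd_sqrt (c d ρ : ℝ) (h : 0 < c + d * ρ) :
    HasDerivAt (fun ρ => √(c + d * ρ)) (d / (2 * √(c + d * ρ))) ρ := by
  have h1 : HasDerivAt (fun ρ => c + d * ρ) d ρ := by
    simpa using ((hasDerivAt_id ρ).const_mul d).const_add c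
  exact h1.sqrt h.ne'

lemma ev_sqrt {K : Type} [Fintype K] (c d : K → ℝ) (ρ0 : ℝ) (h : ∀ k, 0 < c k + d k * ρ0) :
    ∃ B : ℝ, ∀ᶠ ρ in nhds ρ0, ∀ k, 0 < c k + d k * ρ ∧ |√(c k + d k * ρ)| ≤ B ∧
      |d k / (2 * √(c k + d k * ρ))| ≤ B := by
  refine ⟨∑ k, (|√(c k + d k * ρ0)| + |d k / (2 * √(c k + d k * ρ0))|) + 1,
    Filter.eventually_all.2 fun k => ?_⟩
  have hle := Finset.single_le_sum
    (f := fun k => |√(c k + d k * ρ0)| + |d k / (2 * √(c k + d k * ρ0))|)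
    (fun i _ => by positivity) (Finset.mem_univ k)
  have n1 := abs_nonneg (√(c k + d k * ρ0))
  have n2 := abs_nonneg (d k / (2 * √(c k + d k * ρ0)))
  have c0 : ContinuousAt (fun ρ => c k + d k * ρ) ρ0 := by fun_prop
  have c1 : ContinuousAt (fun ρ => |√(c k + d k * ρ)|) ρ0 := by fun_prop
  have c2 : ContinuousAt (fun ρ => |d k / (2 * √(c k + d k * ρ))|) ρ0 := by
    refine (ContinuousAt.div continuousAt_const (by fun_prop) ?_).abs
    have := sqrt_pos.2 (h k)
    positivity
  have e0 := c0.eventually (lt_mem_nhds (h k))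
  have e1 := c1.eventually (gt_mem_nhds (lt_add_one _))
  have e2 := c2.eventually (gt_mem_nhds (lt_add_one _))
  filter_upwards [e0, e1, e2] with ρ h0 h1 h2
  exact ⟨h0, by linarith, by linarith⟩

/-- matrix part of the exponent -/
def gg (t : ℝ) (x : Fin l → Fin n → ℝ) (y : Fin l → Fin m → ℝ) (i : Fin l × Fin l)
    (G : Fin m → Fin n → ℝ) : ℝ := √t * ∑ j, ∑ k, y i.2 j * (G j k * x i.1 k)

/-- coefficient vectors -/
def vv (t : ℝ) (x : Fin l → Fin n → ℝ) (y : Fin l → Fin m → ℝ) (k : Kx m n) (i : Fin l × Fin l) : ℝ :=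
  Sum.elim (fun _ => √t * nrm2 (x i.1) * nrm2 (y i.2))
    (Sum.elim (fun j => √(1 - t) * nrm2 (x i.1) * y i.2 j)
      (fun j => √(1 - t) * nrm2 (y i.2) * x i.1 j)) k

/-- coefficients constant on each of the three kinds of coordinates -/
def kv (c1 c2 c3 : ℝ) (k : Kx m n) : ℝ :=
  Sum.elim (fun _ => c1) (Sum.elim (fun _ => c2) (fun _ => c3)) k

/-- concrete field -/
def TT (t : ℝ) (x : Fin l → Fin n → ℝ) (y : Fin l → Fin m → ℝ) (ca cb db : Kx m n → ℝ) (ρ : ℝ)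
    (ω : (Fin m → Fin n → ℝ) × Us m n) (U : Us m n) (i : Fin l × Fin l) : ℝ :=
  gg t x y i ω.1 + ∑ k, vv t x y k i *
    (√(ca k + -db k * ρ) * xi k U + √(cb k + db k * ρ) * xi k ω.2)

lemma gg_bound (t : ℝ) (x : Fin l → Fin n → ℝ) (y : Fin l → Fin m → ℝ) (i : Fin l × Fin l) :
    ∃ C : ℝ, 0 ≤ C ∧ ∀ G, |gg t x y i G| ≤ C * ∑ j, ∑ k, |G j k| := by
  refine ⟨√t * ∑ j, ∑ k, |y i.2 j| * |x i.1 k|, by positivity, fun G => ?_⟩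
  unfold gg
  rw [abs_mul, abs_of_nonneg (sqrt_nonneg t), mul_assoc]
  refine mul_le_mul_of_nonneg_left ?_ (sqrt_nonneg t)
  rw [Finset.mul_sum]
  refine (Finset.abs_sum_le_sum_abs _ _).trans (Finset.sum_le_sum fun j _ => ?_)
  rw [Finset.mul_sum]
  refine (Finset.abs_sum_le_sum_abs _ _).trans (Finset.sum_le_sum fun k _ => ?_)
  have h1 : |y i.2 j| * |x i.1 k| ≤ ∑ j, ∑ k, |y i.2 j| * |x i.1 k| :=
    (Finset.single_le_sum (f := fun k => |y i.2 j| * |x i.1 k|) (fun _ _ => by positivity)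
      (Finset.mem_univ k)).trans
    (Finset.single_le_sum (f := fun j => ∑ k, |y i.2 j| * |x i.1 k|) (fun _ _ => by positivity)
      (Finset.mem_univ j))
  rw [abs_mul, abs_mul]
  calc |y i.2 j| * (|G j k| * |x i.1 k|) = (|y i.2 j| * |x i.1 k|) * |G j k| := by ring
    _ ≤ _ := mul_le_mul_of_nonneg_right h1 (abs_nonneg _)

theorem conc_deriv (i0 : Fin l) (β s m1 t : ℝ) (x : Fin l → Fin n → ℝ) (y : Fin l → Fin m → ℝ)
    (ca cb db : Kx m n → ℝ) (ρ0 : ℝ) (hA : ∀ k, 0 < ca k + -db k * ρ0)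
    (hB : ∀ k, 0 < cb k + db k * ρ0)
    (q : Kx m n → (Fin m → Fin n → ℝ) × Us m n → ℝ)
    (hq : ∀ k ω, q k ω = (∫ U, ∑ i, vv t x y k i * cF1 β s m1 i (TT t x y ca cb db ρ0 ω U) ∂ muU m n) /
      (∫ U, cF β s m1 (TT t x y ca cb db ρ0 ω U) ∂ muU m n)) :
    HasDerivAt (fun ρ => ∫ ω, log (∫ U, cF β s m1 (TT t x y ca cb db ρ ω U) ∂ muU m n) ∂ muGU m n)
      (-∑ k, db k / 2 * ∫ ω, q k ω ^ 2 ∂ muGU m n) ρ0 ∧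
    (∀ k, Integrable (fun ω => q k ω ^ 2) (muGU m n)) ∧
    (∀ ω i, Integrable (fun U => cF1 β s m1 i (TT t x y ca cb db ρ0 ω U)) (muU m n)) := by
  obtain ⟨B1, h1⟩ := ev_sqrt ca (fun k => -db k) ρ0 hA
  obtain ⟨B2, h2⟩ := ev_sqrt cb db ρ0 hB
  obtain ⟨ε, hε, hb⟩ := Metric.eventually_nhds_iff_ball.1 (h1.and h2)
  let d : Dat m n (Fin l × Fin l) :=
    { F := cF β s m1
      F1 := cF1 β s m1
      F2 := cF2 β s m1
      g := gg t x y
      v := vv t x y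
      a := fun k ρ => √(ca k + -db k * ρ)
      a' := fun k ρ => -db k / (2 * √(ca k + -db k * ρ))
      b := fun k ρ => √(cb k + db k * ρ)
      b' := fun k ρ => db k / (2 * √(cb k + db k * ρ))
      ρ0 := ρ0
      ε := ε
      hε := hε
      hF := CD_cF i0
      hF1 := CD_cF1
      pos := cF_pos i0
      eF := e_cF i0 m1
      eFi := e_cFi i0
      eF1 := e_cF1
      eF2 := e_cF2
      gc := fun i => by unfold gg; fun_prop
      gb := gg_bound t x y
      ha := fun ρ hρ k => hd_sqrt _ _ _ ((hb ρ hρ).1 k).1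
      hb := fun ρ hρ k => hd_sqrt _ _ _ ((hb ρ hρ).2 k).1
      bd := ⟨max B1 B2, fun ρ hρ k =>
        ⟨((hb ρ hρ).1 k).2.1.trans (le_max_left _ _), ((hb ρ hρ).1 k).2.2.trans (le_max_left _ _),
          ((hb ρ hρ).2 k).2.1.trans (le_max_right _ _), ((hb ρ hρ).2 k).2.2.trans (le_max_right _ _)⟩⟩
      hab := fun k => by
        have e1 := sqrt_pos.2 (hA k)
        have e2 := sqrt_pos.2 (hB k)
        generalize √(ca k + -db k * ρ0) = A at *
        generalize √(cb k + db k * ρ0) = B at *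
        field_simp }
  have hqd : ∀ k, d.q k = q k := fun k => funext fun ω => (hq k ω).symm
  refine ⟨?_, fun k => ?_, fun ω i => ?_⟩
  · refine d.main.congr_deriv ?_
    congr 1
    refine Finset.sum_congr rfl fun k _ => ?_
    rw [hqd]
    congr 1
    change √(cb k + db k * ρ0) * (db k / (2 * √(cb k + db k * ρ0))) = db k / 2
    have e2 := sqrt_pos.2 (hB k)
    field_simp
  · rw [← hqd]; exact d.int_q2 k
  · exact d.int_U (d.hF1 i).cont (d.eF1 i) _ d.mem0 ω

lemma TT_eq {β s m1 t p0 p1 q0 q1 : ℝ} {x : Fin l → Fin n → ℝ} {y : Fin l → Fin m → ℝ}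
    {a1 a2 a3 b1 b2 b3 d1 d2 d3 ρ : ℝ}
    (ha1 : a1 + -d1 * ρ = p0 * q0 - p1 * q1) (ha2 : a2 + -d2 * ρ = p0 - p1)
    (ha3 : a3 + -d3 * ρ = q0 - q1)
    (hb1 : b1 + d1 * ρ = p1 * q1) (hb2 : b2 + d2 * ρ = p1) (hb3 : b3 + d3 * ρ = q1)
    (ω : (Fin m → Fin n → ℝ) × Us m n) (U : Us m n) (i : Fin l × Fin l) :
    TT t x y (kv a1 a2 a3) (kv b1 b2 b3) (kv d1 d2 d3) ρ ω U i =
      D0 β s t m1 p0 p1 q0 q1 x y ω.1 U ω.2 i.1 i.2 := by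
  unfold TT D0 gg
  rw [Fintype.sum_sum_type, Fintype.sum_sum_type]
  simp only [kv, vv, Sum.elim_inl, Sum.elim_inr, xi, ha1, ha2, ha3, hb1, hb2, hb3]
  simp only [Finset.univ_unique, Finset.sum_singleton, mul_assoc, ← Finset.mul_sum]
  have e : ∀ k, (√(q0 - q1) * U.2.2 k + √q1 * ω.2.2.2 k) * x i.1 k =
      x i.1 k * (√(q0 - q1) * U.2.2 k + √q1 * ω.2.2.2 k) := fun k => mul_comm _ _
  simp only [e]
  ring

lemma sq_expand {K I : Type} [Fintype K] [Fintype I] (v : K → I → ℝ) (Φ : I → ℝ) :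
    ∑ k, (∑ i, v k i * Φ i) ^ 2 = ∑ i, ∑ p, (∑ k, v k i * v k p) * (Φ i * Φ p) := by
  simp only [pow_two, Finset.sum_mul_sum]
  simp only [Finset.sum_mul]
  rw [Finset.sum_comm]
  refine Finset.sum_congr rfl fun i _ => ?_
  rw [Finset.sum_comm]
  exact Finset.sum_congr rfl fun p _ => Finset.sum_congr rfl fun k _ => by ring

theorem psi_deriv (i0 : Fin l) (hn : 1 ≤ n) (β s t m1 p0 p1 q0 q1 : ℝ)
    (hβ : 0 < β) (hs : s ≠ 0) (ht : t ∈ Set.Ioo (0:ℝ) 1) (hm1 : m1 ∈ Set.Ioc (0:ℝ) 1)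
    (x : Fin l → Fin n → ℝ) (y : Fin l → Fin m → ℝ)
    (hp01 : p1 < p0) (hp1pos : 0 < p1) (hq01 : q1 < q0) (hq1pos : 0 < q1)
    (hpq : p1 * q1 < p0 * q0) (hpqpos : 0 < p1 * q1)
    (a1 a2 a3 b1 b2 b3 d1 d2 d3 ρ0 : ℝ) (P Q : ℝ → ℝ) (hP : P ρ0 = p1) (hQ : Q ρ0 = q1)
    (ha1 : ∀ ρ, a1 + -d1 * ρ = p0 * q0 - P ρ * Q ρ) (ha2 : ∀ ρ, a2 + -d2 * ρ = p0 - P ρ)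
    (ha3 : ∀ ρ, a3 + -d3 * ρ = q0 - Q ρ)
    (hb1 : ∀ ρ, b1 + d1 * ρ = P ρ * Q ρ) (hb2 : ∀ ρ, b2 + d2 * ρ = P ρ)
    (hb3 : ∀ ρ, b3 + d3 * ρ = Q ρ) :
    HasDerivAt (fun ρ => psiq β s t m1 p0 (P ρ) q0 (Q ρ) x y)
      (-(Real.sign s * s * β * m1 / (2 * Real.sqrt (n : ℝ))) *
        (d1 * (t * EB2 β s t m1 p0 p1 q0 q1 x y (fun i1 i2 pp1 pp2 => nrm2 (x i1) * nrm2 (x pp1) * nrm2 (y i2) * nrm2 (y pp2)))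
        + d2 * ((1 - t) * EB2 β s t m1 p0 p1 q0 q1 x y (fun i1 i2 pp1 pp2 => nrm2 (x i1) * nrm2 (x pp1) * dotv (y pp2) (y i2)))
        + d3 * ((1 - t) * EB2 β s t m1 p0 p1 q0 q1 x y (fun i1 i2 pp1 pp2 => nrm2 (y i2) * nrm2 (y pp2) * dotv (x pp1) (x i1))))) ρ0 := by
  set q : Kx m n → (Fin m → Fin n → ℝ) × Us m n → ℝ := fun k ω =>
    m1 * s * β * ∑ i : Fin l × Fin l, vv t x y k i *
      Phiq β s t m1 p0 p1 q0 q1 x y ω.1 ω.2 (gam0 β s t m1 p0 p1 q0 q1 x y ω.1 ω.2 i.1 i.2) with hqdef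
  have eT : ∀ ρ ω U, TT t x y (kv a1 a2 a3) (kv b1 b2 b3) (kv d1 d2 d3) ρ ω U =
      fun i => D0 β s t m1 p0 (P ρ) q0 (Q ρ) x y ω.1 U ω.2 i.1 i.2 := fun ρ ω U => funext fun i =>
    TT_eq (ha1 ρ) (ha2 ρ) (ha3 ρ) (hb1 ρ) (hb2 ρ) (hb3 ρ) ω U i
  have eF : ∀ ρ ω U, cF β s m1 (TT t x y (kv a1 a2 a3) (kv b1 b2 b3) (kv d1 d2 d3) ρ ω U) =
      Zq β s t m1 p0 (P ρ) q0 (Q ρ) x y ω.1 U ω.2 ^ m1 := fun ρ ω U => by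
    rw [eT]; rfl
  have eg : ∀ ω U i, cg β s i (TT t x y (kv a1 a2 a3) (kv b1 b2 b3) (kv d1 d2 d3) ρ0 ω U) =
      gam0 β s t m1 p0 p1 q0 q1 x y ω.1 ω.2 i.1 i.2 U := fun ω U i => by
    rw [eT, hP, hQ]; rfl
  have hA : ∀ k : Kx m n, 0 < kv a1 a2 a3 k + -kv d1 d2 d3 k * ρ0 := by
    rintro (_ | _ | _) <;> simp only [kv, Sum.elim_inl, Sum.elim_inr, ha1, ha2, ha3, hP, hQ] <;> linarith
  have hB : ∀ k : Kx m n, 0 < kv b1 b2 b3 k + kv d1 d2 d3 k * ρ0 := by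
    rintro (_ | _ | _) <;> simp only [kv, Sum.elim_inl, Sum.elim_inr, hb1, hb2, hb3, hP, hQ] <;> linarith
  obtain ⟨_, _, iF1⟩ := conc_deriv i0 β s m1 t x y (kv a1 a2 a3) (kv b1 b2 b3)
    (kv d1 d2 d3) ρ0 hA hB _ (fun _ _ => rfl)
  obtain ⟨hD, iq, _⟩ := conc_deriv i0 β s m1 t x y (kv a1 a2 a3) (kv b1 b2 b3)
    (kv d1 d2 d3) ρ0 hA hB q (fun k ω => by
      rw [integral_finsetSum]
      swap
      · intro i _
        exact (iF1 ω i).const_mul _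
      simp only [integral_const_mul, cF1, eF, eg, hP, hQ]
      rw [hqdef, Finset.sum_div]
      simp only [Phiq]
      rw [Finset.mul_sum]
      exact Finset.sum_congr rfl fun i _ => by ring)
  have epsi : (fun ρ => psiq β s t m1 p0 (P ρ) q0 (Q ρ) x y) = fun ρ =>
      (β * |s| * √(n : ℝ) * m1)⁻¹ * ∫ ω, log (∫ U, cF β s m1
        (TT t x y (kv a1 a2 a3) (kv b1 b2 b3) (kv d1 d2 d3) ρ ω U) ∂ muU m n) ∂ muGU m n := by
    ext ρ
    simp only [eF]
    rw [← integral_const_mul]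
    rfl
  rw [epsi]
  refine (hD.const_mul _).congr_deriv ?_
  have st : √t * √t = t := mul_self_sqrt ht.1.le
  have st' : √(1 - t) * √(1 - t) = 1 - t := mul_self_sqrt (by linarith [ht.2])
  have key : ∀ (K : Type) [Fintype K] (κ : K → Kx m n) (c : ℝ) (f : Fin l → Fin l → Fin l → Fin l → ℝ),
      (∀ i p : Fin l × Fin l, ∑ k, vv t x y (κ k) i * vv t x y (κ k) p = c * f i.1 i.2 p.1 p.2) →
      ∑ k, ∫ ω, q (κ k) ω ^ 2 ∂ muGU m n =
        (m1 * s * β) ^ 2 * (c * EB2 β s t m1 p0 p1 q0 q1 x y f) := by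
    intro K _ κ c f hf
    rw [← integral_finsetSum _ fun k _ => iq (κ k)]
    unfold EB2
    rw [← integral_const_mul, ← integral_const_mul]
    congr 1; ext ω
    simp only [hqdef, mul_pow _ (∑ _, _)]
    rw [← Finset.mul_sum, sq_expand (fun k => vv t x y (κ k))]
    congr 1
    simp only [hf]
    rw [Fintype.sum_prod_type]
    simp only [Fintype.sum_prod_type, Finset.mul_sum, gam2, mul_assoc]
  have k1 := key Unit (fun _ => Sum.inl ()) t
    (fun i1 i2 pp1 pp2 => nrm2 (x i1) * nrm2 (x pp1) * nrm2 (y i2) * nrm2 (y pp2)) (fun i p => by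
      simp only [vv, Sum.elim_inl, Finset.univ_unique, Finset.sum_singleton]
      linear_combination (nrm2 (x i.1) * nrm2 (x p.1) * nrm2 (y i.2) * nrm2 (y p.2)) * st)
  have k2 := key (Fin m) (fun j => Sum.inr (Sum.inl j)) (1 - t)
    (fun i1 i2 pp1 pp2 => nrm2 (x i1) * nrm2 (x pp1) * dotv (y pp2) (y i2)) (fun i p => by
      simp only [vv, Sum.elim_inl, Sum.elim_inr, dotv, Finset.mul_sum]
      refine Finset.sum_congr rfl fun j _ => ?_
      linear_combination (nrm2 (x i.1) * nrm2 (x p.1) * (y p.2 j * y i.2 j)) * st')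
  have k3 := key (Fin n) (fun j => Sum.inr (Sum.inr j)) (1 - t)
    (fun i1 i2 pp1 pp2 => nrm2 (y i2) * nrm2 (y pp2) * dotv (x pp1) (x i1)) (fun i p => by
      simp only [vv, Sum.elim_inr, dotv, Finset.mul_sum]
      refine Finset.sum_congr rfl fun j _ => ?_
      linear_combination (nrm2 (y i.2) * nrm2 (y p.2) * (x p.1 j * x i.1 j)) * st')
  rw [Fintype.sum_sum_type, Fintype.sum_sum_type]
  simp only [kv, Sum.elim_inl, Sum.elim_inr, ← Finset.mul_sum]
  rw [k1, k2, k3]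
  generalize EB2 β s t m1 p0 p1 q0 q1 x y _ = E1
  generalize EB2 β s t m1 p0 p1 q0 q1 x y _ = E2
  generalize EB2 β s t m1 p0 p1 q0 q1 x y _ = E3
  have hn' : 0 < √(n : ℝ) := sqrt_pos.2 (by exact_mod_cast hn)
  have hm := hm1.1
  have hsgn : Real.sign s * s = |s| := by
    rcases lt_or_gt_of_ne hs with h | h
    · rw [Real.sign_of_neg h, abs_of_neg h]; ring
    · rw [Real.sign_of_pos h, abs_of_pos h]; ring
  have hs2 : s ^ 2 = |s| ^ 2 := (sq_abs s).symm
  have hs0 : 0 < |s| := abs_pos.2 hs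
  rw [hsgn, mul_pow, mul_pow, hs2]
  field_simp
  ring

/-- Proposition 1: first-level `p₁`,`q₁`-derivatives of `ψ`. -/
theorem first_level_pq_derivatives
    (m n l : ℕ) (hm : 1 ≤ m) (hn : 1 ≤ n) (hl : 1 ≤ l)
    (β s t m1 p0 p1 q0 q1 : ℝ)
    (hβ : 0 < β) (hs : s ≠ 0) (ht : t ∈ Set.Ioo (0:ℝ) 1) (hm1 : m1 ∈ Set.Ioc (0:ℝ) 1)
    (hp : p1 ≤ p0) (hp1 : 0 ≤ p1) (hq : q1 ≤ q0) (hq1 : 0 ≤ q1)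
    (x : Fin l → Fin n → ℝ) (y : Fin l → Fin m → ℝ)
    (hx : ∀ i, x i ≠ 0) (hy : ∀ i, y i ≠ 0)
    (hp01 : p1 < p0) (hp1pos : 0 < p1) (hq01 : q1 < q0) (hq1pos : 0 < q1)
    (hpq : p1 * q1 < p0 * q0) (hpqpos : 0 < p1 * q1) :
    HasDerivAt (fun ρ => psiq β s t m1 p0 ρ q0 q1 x y)
      (-(Real.sign s * s * β * m1 / (2 * Real.sqrt (n : ℝ))) *
        ((1 - t) * EB2 β s t m1 p0 p1 q0 q1 x y (fun i1 i2 pp1 pp2 => nrm2 (x i1) * nrm2 (x pp1) * dotv (y pp2) (y i2))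
          + t * q1 * EB2 β s t m1 p0 p1 q0 q1 x y (fun i1 i2 pp1 pp2 => nrm2 (x i1) * nrm2 (x pp1) * nrm2 (y i2) * nrm2 (y pp2)))) p1
    ∧
    HasDerivAt (fun ρ => psiq β s t m1 p0 p1 q0 ρ x y)
      (-(Real.sign s * s * β * m1 / (2 * Real.sqrt (n : ℝ))) *
        ((1 - t) * EB2 β s t m1 p0 p1 q0 q1 x y (fun i1 i2 pp1 pp2 => nrm2 (y i2) * nrm2 (y pp2) * dotv (x pp1) (x i1))
          + t * p1 * EB2 β s t m1 p0 p1 q0 q1 x y (fun i1 i2 pp1 pp2 => nrm2 (x i1) * nrm2 (x pp1) * nrm2 (y i2) * nrm2 (y pp2)))) q1 := by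
  have i0 : Fin l := ⟨0, hl⟩
  constructor
  · refine (psi_deriv i0 hn β s t m1 p0 p1 q0 q1 hβ hs ht hm1 x y hp01 hp1pos hq01 hq1pos hpq hpqpos
      (p0 * q0) p0 (q0 - q1) 0 0 q1 q1 1 0 p1 (fun ρ => ρ) (fun _ => q1) rfl rfl
      (fun ρ => by ring) (fun ρ => by ring) (fun ρ => by ring) (fun ρ => by ring) (fun ρ => by ring)
      (fun ρ => by ring)).congr_deriv ?_
    ring
  · refine (psi_deriv i0 hn β s t m1 p0 p1 q0 q1 hβ hs ht hm1 x y hp01 hp1pos hq01 hq1pos hpq hpqpos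
      (p0 * q0) (p0 - p1) q0 0 p1 0 p1 0 1 q1 (fun _ => p1) (fun ρ => ρ) rfl rfl
      (fun ρ => by ring) (fun ρ => by ring) (fun ρ => by ring) (fun ρ => by ring) (fun ρ => by ring)
      (fun ρ => by ring)).congr_deriv ?_
    ring

end

end SFL
end
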